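/- arXiv:2401.05456 — 4 statements merged into one kernel-verified Lean document; each statement's English description precedes it below -/
import Mathlib

section
/- For complex square matrices A and B and real p ≥ 2, one has 2·(‖A‖_p^p + ‖B‖_p^p) ≤ ‖A+B‖_p^p + ‖A−B‖_p^p. -/
open scoped ComplexOrder

/-- The Schatten `p`-(quasi)norm of a square complex matrix:
`‖X‖_p = (tr |X|^p)^(1/p)`, computed as `(∑ i, λ_i(Xᴴ * X) ^ (p/2)) ^ (1/p)`,
where `λ_i(Xᴴ * X)` are the (nonnegative) eigenvalues of `Xᴴ * X`, whose square
roots are the singular values of `X`. -/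
noncomputable def schattenNorm {m : Type*} [Fintype m] [DecidableEq m]
    (p : ℝ) (X : Matrix m m ℂ) : ℝ :=
  (∑ i, ((Matrix.posSemidef_conjTranspose_mul_self X).1.eigenvalues i ^ (p / 2))) ^ (1 / p)

section DiagForm

variable {ι κ E : Type*} [Fintype ι] [Fintype κ] [NormedAddCommGroup E] [InnerProductSpace ℂ E]

/-- The quadratic form that is diagonal in the orthonormal basis `b` with diagonal entries `c`. -/
noncomputable def diagForm (b : OrthonormalBasis ι ℂ E) (c : ι → ℝ) (x : E) : ℝ :=
  ∑ i, c i * ‖inner ℂ (b i) x‖ ^ 2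

lemma diagForm_nonneg (b : OrthonormalBasis ι ℂ E) {c : ι → ℝ} (hc : ∀ i, 0 ≤ c i) (x : E) :
    0 ≤ diagForm b c x :=
  Finset.sum_nonneg fun i _ => mul_nonneg (hc i) (sq_nonneg _)

lemma diagForm_apply_basis (b : OrthonormalBasis ι ℂ E) (c : ι → ℝ) (i : ι) :
    diagForm b c (b i) = c i := by
  classical
  rw [diagForm, Finset.sum_eq_single i]
  · simp
  · intro j _ hj
    simp [b.inner_eq_zero hj]
  · simp

/-- **Peierls' inequality** for the power functions. -/
lemma sum_diagForm_rpow_le (b : OrthonormalBasis ι ℂ E) (u : OrthonormalBasis κ ℂ E)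
    {c : ι → ℝ} (hc : ∀ i, 0 ≤ c i) {q : ℝ} (hq : 1 ≤ q) :
    ∑ k, diagForm b c (u k) ^ q ≤ ∑ i, c i ^ q := by
  calc ∑ k, diagForm b c (u k) ^ q
      ≤ ∑ k, ∑ i, ‖inner ℂ (b i) (u k)‖ ^ 2 * c i ^ q := by
        refine Finset.sum_le_sum fun k _ => ?_
        have h := Real.rpow_arith_mean_le_arith_mean_rpow Finset.univ
          (fun i => ‖inner ℂ (b i) (u k)‖ ^ 2) c (fun i _ => sq_nonneg _)
          (by rw [b.sum_sq_norm_inner_right]; simp) (fun i _ => hc i) hq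
        simpa only [diagForm, mul_comm] using h
    _ = ∑ i, c i ^ q := by
        rw [Finset.sum_comm]
        refine Finset.sum_congr rfl fun i _ => ?_
        rw [← Finset.sum_mul, u.sum_sq_norm_inner_left]
        simp

lemma rpow_ge_one_add_mul_one_sub_inv {t s : ℝ} (ht : 0 < t) (hs : 0 ≤ s) :
    1 + s * (1 - t⁻¹) ≤ t ^ s := by
  rw [Real.rpow_def_of_pos ht]
  have h₁ := mul_le_mul_of_nonneg_left (Real.one_sub_inv_le_log_of_pos ht) hs
  have h₂ := Real.add_one_le_exp (Real.log t * s)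
  linarith

/-- If a rank one form `r • |⟪v, ·⟫|²` is dominated by a diagonal form, then `r ^ s` is at most
the value at `v` of the `s`-th power of the diagonal form. -/
lemma rpow_le_diagForm_rpow (u : OrthonormalBasis ι ℂ E) {c : ι → ℝ} (hc : ∀ i, 0 ≤ c i)
    {v : E} (hv : ‖v‖ = 1) {r : ℝ} (hr : 0 < r) {s : ℝ} (hs : 0 ≤ s)
    (h : ∀ x, r * ‖inner ℂ v x‖ ^ 2 ≤ diagForm u c x) :
    r ^ s ≤ diagForm u (fun i => c i ^ s) v := by
  have hzero : ∀ i, c i = 0 → ‖inner ℂ (u i) v‖ ^ 2 = 0 := by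
    intro i hi
    have h₁ := h (u i)
    rw [diagForm_apply_basis, hi, norm_inner_symm] at h₁
    exact le_antisymm (nonpos_of_mul_nonpos_right h₁ hr) (sq_nonneg _)
  have hone : ∑ i, ‖inner ℂ (u i) v‖ ^ 2 = 1 := by
    rw [u.sum_sq_norm_inner_right, hv, one_pow]
  set S : ℝ := diagForm u (fun i => (c i)⁻¹) v with hS
  have hS0 : 0 ≤ S := diagForm_nonneg u (fun i => inv_nonneg.2 (hc i)) v
  have hSle : r * S ≤ 1 := by
    set x : E := u.repr.symm (WithLp.toLp 2 fun i => ((c i)⁻¹ : ℂ) * inner ℂ (u i) v)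
    have hx : ∀ i, inner ℂ (u i) x = ((c i)⁻¹ : ℂ) * inner ℂ (u i) v := by
      intro i
      rw [← u.repr_apply_apply]
      simp [x]
    have hvx : inner ℂ v x = (S : ℂ) := by
      rw [← u.sum_inner_mul_inner v x, hS, diagForm, Complex.ofReal_sum]
      refine Finset.sum_congr rfl fun i _ => ?_
      rw [hx, mul_left_comm, ← inner_conj_symm v, ← Complex.normSq_eq_conj_mul_self,
        Complex.normSq_eq_norm_sq]
      push_cast
      rfl
    have hxx : diagForm u c x = S := by
      refine Finset.sum_congr rfl fun i _ => ?_
      rw [hx, norm_mul, mul_pow, norm_inv, Complex.norm_real, Real.norm_of_nonneg (hc i)]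
      rcases eq_or_ne (c i) 0 with hi | hi
      · simp [hi]
      · field_simp
    have h₁ := h x
    rw [hxx, hvx, Complex.norm_real, Real.norm_of_nonneg hS0] at h₁
    rcases hS0.eq_or_lt with h₀ | h₀
    · simp [← h₀]
    · nlinarith
  calc r ^ s ≤ r ^ s * (1 + s * (1 - r * S)) := by
        refine le_mul_of_one_le_right (Real.rpow_nonneg hr.le s) ?_
        nlinarith [mul_nonneg hs (sub_nonneg.2 hSle)]
    _ = ∑ i, r ^ s * (1 + s * (1 - r * (c i)⁻¹)) * ‖inner ℂ (u i) v‖ ^ 2 := by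
        have : ∀ i, r ^ s * (1 + s * (1 - r * (c i)⁻¹)) * ‖inner ℂ (u i) v‖ ^ 2 =
            r ^ s * (1 + s) * ‖inner ℂ (u i) v‖ ^ 2 -
              r ^ s * s * r * ((c i)⁻¹ * ‖inner ℂ (u i) v‖ ^ 2) := fun i => by ring
        rw [Finset.sum_congr rfl fun i _ => this i, Finset.sum_sub_distrib, ← Finset.mul_sum,
          ← Finset.mul_sum, hone, hS, diagForm]
        ring
    _ ≤ diagForm u (fun i => c i ^ s) v := by
        refine Finset.sum_le_sum fun i _ => ?_
        rcases (hc i).eq_or_lt with hi | hi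
        · simp [hzero i hi.symm]
        · refine mul_le_mul_of_nonneg_right ?_ (sq_nonneg _)
          have h₁ := rpow_ge_one_add_mul_one_sub_inv (div_pos hi hr) hs
          rw [Real.div_rpow hi.le hr.le, le_div_iff₀ (Real.rpow_pos_of_pos hr s), inv_div,
            div_eq_mul_inv] at h₁
          linarith

lemma sum_rpow_add_one_le (u : OrthonormalBasis ι ℂ E) {c : ι → ℝ} (hc : ∀ i, 0 ≤ c i)
    (v : OrthonormalBasis κ ℂ E) {a : κ → ℝ} (ha : ∀ k, 0 ≤ a k) {s : ℝ} (hs : 0 ≤ s)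
    (h : ∀ x, diagForm v a x ≤ diagForm u c x) :
    ∑ k, a k ^ (s + 1) ≤ ∑ i, c i ^ s * diagForm v a (u i) := by
  calc ∑ k, a k ^ (s + 1) ≤ ∑ k, a k * diagForm u (fun i => c i ^ s) (v k) := by
        refine Finset.sum_le_sum fun k _ => ?_
        rw [Real.rpow_add_one' (ha k) (by positivity), mul_comm]
        rcases (ha k).eq_or_lt with hk | hk
        · simp [← hk]
        · refine mul_le_mul_of_nonneg_left ?_ hk.le
          refine rpow_le_diagForm_rpow u hc (v.norm_eq_one k) hk hs fun x => (h x).trans' ?_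
          exact Finset.single_le_sum (f := fun k => a k * ‖inner ℂ (v k) x‖ ^ 2)
            (fun j _ => mul_nonneg (ha j) (sq_nonneg _)) (Finset.mem_univ k)
    _ = ∑ i, c i ^ s * diagForm v a (u i) := by
        simp only [diagForm, Finset.mul_sum]
        rw [Finset.sum_comm]
        refine Finset.sum_congr rfl fun i _ => Finset.sum_congr rfl fun k _ => ?_
        rw [norm_inner_symm]
        ring

/-- **McCarthy's inequality**: superadditivity of `tr (· ^ (s + 1))` on positive forms. -/
lemma sum_rpow_add_sum_rpow_le (u v w : OrthonormalBasis ι ℂ E) {c a b : ι → ℝ}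
    (hc : ∀ i, 0 ≤ c i) (ha : ∀ i, 0 ≤ a i) (hb : ∀ i, 0 ≤ b i) {s : ℝ} (hs : 0 ≤ s)
    (h : ∀ x, diagForm u c x = diagForm v a x + diagForm w b x) :
    ∑ i, a i ^ (s + 1) + ∑ i, b i ^ (s + 1) ≤ ∑ i, c i ^ (s + 1) := by
  have h₁ := sum_rpow_add_one_le u hc v ha hs fun x => by
    linarith [h x, diagForm_nonneg w hb x]
  have h₂ := sum_rpow_add_one_le u hc w hb hs fun x => by
    linarith [h x, diagForm_nonneg v ha x]
  refine (add_le_add h₁ h₂).trans_eq ?_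
  rw [← Finset.sum_add_distrib]
  refine Finset.sum_congr rfl fun i _ => ?_
  rw [← mul_add, ← h, diagForm_apply_basis, Real.rpow_add_one' (hc i) (by positivity)]

/-- Midpoint convexity of `tr (· ^ q)` on positive forms. -/
lemma two_mul_sum_rpow_le (u v w : OrthonormalBasis ι ℂ E) {c a b : ι → ℝ}
    (ha : ∀ i, 0 ≤ a i) (hb : ∀ i, 0 ≤ b i) {q : ℝ} (hq : 1 ≤ q)
    (h : ∀ x, 2 * diagForm u c x = diagForm v a x + diagForm w b x) :
    2 * ∑ i, c i ^ q ≤ ∑ i, a i ^ q + ∑ i, b i ^ q := by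
  refine le_trans ?_ (add_le_add (sum_diagForm_rpow_le v u ha hq) (sum_diagForm_rpow_le w u hb hq))
  rw [← Finset.sum_add_distrib, Finset.mul_sum]
  refine Finset.sum_le_sum fun i _ => ?_
  have h₁ := (convexOn_rpow hq).2 (diagForm_nonneg v ha (u i)) (diagForm_nonneg w hb (u i))
    (by norm_num : (0 : ℝ) ≤ 1 / 2) (by norm_num : (0 : ℝ) ≤ 1 / 2) (by norm_num)
  have h₂ := h (u i)
  rw [diagForm_apply_basis] at h₂
  simp only [smul_eq_mul] at h₁
  rw [← mul_add, ← h₂, one_div, inv_mul_cancel_left₀ two_ne_zero] at h₁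
  linarith

end DiagForm

section Matrix

open scoped Matrix

variable {m : Type*} [Fintype m] [DecidableEq m]

lemma Matrix.IsHermitian.diagForm_eigenvectorBasis {H : Matrix m m ℂ} (hH : H.IsHermitian)
    (x : EuclideanSpace ℂ m) :
    diagForm hH.eigenvectorBasis hH.eigenvalues x = (inner ℂ x (H.toEuclideanLin x)).re := by
  have hsymm := Matrix.isSymmetric_toEuclideanLin_iff.2 hH
  have hu : ∀ j, H.toEuclideanLin (hH.eigenvectorBasis j) =
      (hH.eigenvalues j : ℂ) • hH.eigenvectorBasis j := by
    intro j
    rw [Matrix.toLpLin_apply, hH.mulVec_eigenvectorBasis]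
    ext i
    simp
  rw [← hH.eigenvectorBasis.sum_inner_mul_inner, Complex.re_sum]
  refine Finset.sum_congr rfl fun j _ => ?_
  rw [← hsymm, hu, inner_smul_left, Complex.conj_ofReal, mul_left_comm,
    ← inner_conj_symm x, ← Complex.normSq_eq_conj_mul_self, ← Complex.ofReal_mul,
    Complex.ofReal_re, Complex.normSq_eq_norm_sq]

lemma Matrix.inner_conjTranspose_mul_self (X : Matrix m m ℂ) (x : EuclideanSpace ℂ m) :
    (inner ℂ x ((Xᴴ * X).toEuclideanLin x)).re = ‖X.toEuclideanLin x‖ ^ 2 := by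
  have : (Xᴴ * X).toEuclideanLin x = Xᴴ.toEuclideanLin (X.toEuclideanLin x) := by
    simp [Matrix.toLpLin_apply]
  rw [this, Matrix.toEuclideanLin_conjTranspose_eq_adjoint, LinearMap.adjoint_inner_right]
  exact inner_self_eq_norm_sq (𝕜 := ℂ) _

lemma schattenNorm_rpow (X : Matrix m m ℂ) {p : ℝ} (hp : p ≠ 0) :
    schattenNorm p X ^ p =
      ∑ i, (Matrix.posSemidef_conjTranspose_mul_self X).1.eigenvalues i ^ (p / 2) := by
  rw [schattenNorm, one_div, Real.rpow_inv_rpow _ hp]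
  exact Finset.sum_nonneg fun i _ => Real.rpow_nonneg
    ((Matrix.posSemidef_conjTranspose_mul_self X).eigenvalues_nonneg i) _

end Matrix

theorem clarkson_second_lower {m : Type*} [Fintype m] [DecidableEq m]
    (A B : Matrix m m ℂ) (p : ℝ) (hp : 2 ≤ p) :
    2 * (schattenNorm p A ^ p + schattenNorm p B ^ p) ≤
      schattenNorm p (A + B) ^ p + schattenNorm p (A - B) ^ p := by
  have hp0 : p ≠ 0 := by positivity
  simp only [schattenNorm_rpow _ hp0]
  have hpsd := fun X : Matrix m m ℂ => Matrix.posSemidef_conjTranspose_mul_self X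
  have hM := (hpsd A).add (hpsd B)
  have hform : ∀ (X : Matrix m m ℂ) (x : EuclideanSpace ℂ m),
      diagForm (hpsd X).1.eigenvectorBasis (hpsd X).1.eigenvalues x =
        ‖X.toEuclideanLin x‖ ^ 2 := fun X x => by
    rw [(hpsd X).1.diagForm_eigenvectorBasis, Matrix.inner_conjTranspose_mul_self]
  have hformM : ∀ x : EuclideanSpace ℂ m,
      diagForm hM.1.eigenvectorBasis hM.1.eigenvalues x =
        ‖A.toEuclideanLin x‖ ^ 2 + ‖B.toEuclideanLin x‖ ^ 2 := fun x => by
    rw [hM.1.diagForm_eigenvectorBasis, map_add, LinearMap.add_apply, inner_add_right,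
      Complex.add_re, Matrix.inner_conjTranspose_mul_self, Matrix.inner_conjTranspose_mul_self]
  have hsuper := sum_rpow_add_sum_rpow_le hM.1.eigenvectorBasis (hpsd A).1.eigenvectorBasis
    (hpsd B).1.eigenvectorBasis hM.eigenvalues_nonneg (hpsd A).eigenvalues_nonneg
    (hpsd B).eigenvalues_nonneg (s := p / 2 - 1) (by linarith)
    fun x => by rw [hformM, hform, hform]
  rw [sub_add_cancel] at hsuper
  have hconv := two_mul_sum_rpow_le hM.1.eigenvectorBasis (hpsd (A + B)).1.eigenvectorBasis
    (hpsd (A - B)).1.eigenvectorBasis (hpsd (A + B)).eigenvalues_nonneg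
    (hpsd (A - B)).eigenvalues_nonneg (q := p / 2) (by linarith)
    fun x => by
      rw [hformM, hform, hform, map_add, map_sub, LinearMap.add_apply, LinearMap.sub_apply,
        parallelogram_law_with_norm ℂ]
  linarith
end

section
/- For complex square matrices A and B and real p ≥ 2, one has ‖A+B‖_p^p + ‖A−B‖_p^p ≤ 2^(p-1)·(‖A‖_p^p + ‖B‖_p^p). -/
open scoped ComplexOrder

/-- The sum of the `q`-th powers of the (real parts of the) eigenvalues of a square matrix,
counted with algebraic multiplicity. -/
noncomputable def Matrix.sumEigenvaluesRpow {n : Type*} [Fintype n] [DecidableEq n]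
    (q : ℝ) (H : Matrix n n ℂ) : ℝ :=
  (H.charpoly.roots.map fun z => z.re ^ q).sum

namespace Matrix

variable {m n : Type*} [Fintype m] [DecidableEq m] [Fintype n] [DecidableEq n]

theorem IsHermitian.sumEigenvaluesRpow_eq {H : Matrix n n ℂ} (hH : H.IsHermitian) (q : ℝ) :
    sumEigenvaluesRpow q H = ∑ i, hH.eigenvalues i ^ q := by
  simp [sumEigenvaluesRpow, hH.roots_charpoly_eq_eigenvalues]

theorem sumEigenvaluesRpow_mul_comm {q : ℝ} (hq : q ≠ 0)
    (M : Matrix m n ℂ) (N : Matrix n m ℂ) :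
    sumEigenvaluesRpow q (M * N) = sumEigenvaluesRpow q (N * M) := by
  have h := congrArg Polynomial.roots (charpoly_mul_comm' M N)
  rw [Polynomial.roots_mul (mul_ne_zero (by simp) (charpoly_monic _).ne_zero),
    Polynomial.roots_mul (mul_ne_zero (by simp) (charpoly_monic _).ne_zero)] at h
  have h' := congrArg (fun s : Multiset ℂ => (s.map fun z => z.re ^ q).sum) h
  simpa [sumEigenvaluesRpow, Multiset.map_nsmul, Multiset.sum_nsmul, Real.zero_rpow hq] using h'

/-- Peierls' inequality for the convex function `x ↦ x ^ q` on `[0, ∞)`. -/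
theorem PosSemidef.sum_diag_rpow_le {H : Matrix n n ℂ} (hH : H.PosSemidef) {q : ℝ}
    (hq : 1 ≤ q) : ∑ i, (H i i).re ^ q ≤ sumEigenvaluesRpow q H := by
  rw [hH.1.sumEigenvaluesRpow_eq]
  set U : Matrix n n ℂ := hH.1.eigenvectorUnitary.1 with hU
  have hUU : U * star U = 1 := Unitary.coe_mul_star_self hH.1.eigenvectorUnitary
  have hUU' : star U * U = 1 := Unitary.coe_star_mul_self hH.1.eigenvectorUnitary
  have hrow (i : n) : ∑ j, Complex.normSq (U i j) = 1 := by
    have h := congrFun (congrFun hUU i) i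
    simp only [mul_apply, star_apply, RCLike.star_def, Complex.mul_conj, one_apply_eq] at h
    exact_mod_cast h
  have hcol (j : n) : ∑ i, Complex.normSq (U i j) = 1 := by
    have h := congrFun (congrFun hUU' j) j
    simp only [mul_apply, star_apply, RCLike.star_def, ← Complex.normSq_eq_conj_mul_self,
      one_apply_eq] at h
    exact_mod_cast h
  have hdiag (i : n) : (H i i).re = ∑ j, Complex.normSq (U i j) • hH.1.eigenvalues j := by
    have h := congrFun (congrFun hH.1.spectral_theorem i) i
    rw [Unitary.conjStarAlgAut_apply, ← hU, mul_apply] at h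
    simp only [mul_diagonal, Function.comp_apply, star_apply, RCLike.star_def] at h
    rw [h, Complex.re_sum]
    refine Finset.sum_congr rfl fun j _ => ?_
    rw [mul_right_comm, Complex.mul_conj]
    simp
  calc ∑ i, (H i i).re ^ q
      ≤ ∑ i, ∑ j, Complex.normSq (U i j) • hH.1.eigenvalues j ^ q := by
        refine Finset.sum_le_sum fun i _ => ?_
        rw [hdiag]
        exact (convexOn_rpow hq).map_sum_le (fun j _ => Complex.normSq_nonneg _) (hrow i)
          fun j _ => hH.eigenvalues_nonneg j
    _ = ∑ j, hH.1.eigenvalues j ^ q := by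
        rw [Finset.sum_comm]
        simp only [smul_eq_mul, ← Finset.sum_mul, hcol, one_mul]

theorem IsHermitian.exists_unitary_sumEigenvaluesRpow_eq {H : Matrix n n ℂ}
    (hH : H.IsHermitian) :
    ∃ U : Matrix n n ℂ, Uᴴ * U = 1 ∧ U * Uᴴ = 1 ∧
      ∀ q, sumEigenvaluesRpow q H = ∑ i, ((Uᴴ * H * U) i i).re ^ q := by
  refine ⟨hH.eigenvectorUnitary, Unitary.coe_star_mul_self _, Unitary.coe_mul_star_self _,
    fun q => ?_⟩
  have h := hH.conjStarAlgAut_star_eigenvectorUnitary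
  rw [Unitary.conjStarAlgAut_star_apply] at h
  rw [hH.sumEigenvaluesRpow_eq, ← star_eq_conjTranspose, h]
  simp

theorem sumEigenvaluesRpow_conj {q : ℝ} (hq : q ≠ 0) {U : Matrix n n ℂ} (hU : U * Uᴴ = 1)
    (H : Matrix n n ℂ) : sumEigenvaluesRpow q (Uᴴ * H * U) = sumEigenvaluesRpow q H := by
  rw [sumEigenvaluesRpow_mul_comm hq, ← Matrix.mul_assoc, hU, Matrix.one_mul]

/-- McCarthy's inequality: superadditivity of `H ↦ tr (H ^ q)` on positive semidefinite
matrices, for `q ≥ 1`. -/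
theorem sumEigenvaluesRpow_add_le {q : ℝ} (hq : 1 ≤ q) (X Y : Matrix n n ℂ) :
    sumEigenvaluesRpow q (Xᴴ * X) + sumEigenvaluesRpow q (Yᴴ * Y) ≤
      sumEigenvaluesRpow q (Xᴴ * X + Yᴴ * Y) := by
  have hq0 : q ≠ 0 := by positivity
  obtain ⟨U, -, hU, hX⟩ :=
    (isHermitian_mul_conjTranspose_self X).exists_unitary_sumEigenvaluesRpow_eq
  obtain ⟨V, -, hV, hY⟩ :=
    (isHermitian_mul_conjTranspose_self Y).exists_unitary_sumEigenvaluesRpow_eq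
  have hT : Xᴴ * X + Yᴴ * Y = (fromRows (Uᴴ * X) (Vᴴ * Y))ᴴ * fromRows (Uᴴ * X) (Vᴴ * Y) := by
    rw [conjTranspose_fromRows_eq_fromCols_conjTranspose, fromCols_mul_fromRows]
    simp only [conjTranspose_mul, conjTranspose_conjTranspose]
    rw [Matrix.mul_assoc, ← Matrix.mul_assoc U, hU, Matrix.mul_assoc, ← Matrix.mul_assoc V, hV,
      Matrix.one_mul, Matrix.one_mul]
  rw [hT, sumEigenvaluesRpow_mul_comm hq0 _ (fromRows _ _), sumEigenvaluesRpow_mul_comm hq0 _ X,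
    sumEigenvaluesRpow_mul_comm hq0 _ Y, hX, hY]
  refine le_trans (le_of_eq ?_) ((posSemidef_self_mul_conjTranspose _).sum_diag_rpow_le hq)
  rw [conjTranspose_fromRows_eq_fromCols_conjTranspose, fromRows_mul_fromCols]
  simp [Fintype.sum_sum_type, Matrix.mul_assoc]

/-- The trace convexity of `H ↦ H ^ q`, for `q ≥ 1`. -/
theorem sumEigenvaluesRpow_two_nsmul_add_le {q : ℝ} (hq : 1 ≤ q) {P Q : Matrix n n ℂ}
    (hP : P.PosSemidef) (hQ : Q.PosSemidef) :
    sumEigenvaluesRpow q (2 • (P + Q)) ≤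
      2 ^ (2 * q - 1) * (sumEigenvaluesRpow q P + sumEigenvaluesRpow q Q) := by
  have hq0 : q ≠ 0 := by positivity
  have hPQ : (2 • (P + Q)).IsHermitian := by
    rw [two_nsmul]
    exact ((hP.add hQ).add (hP.add hQ)).1
  obtain ⟨U, -, hU, hS⟩ := hPQ.exists_unitary_sumEigenvaluesRpow_eq
  have hP' := hP.conjTranspose_mul_mul_same U
  have hQ' := hQ.conjTranspose_mul_mul_same U
  rw [hS, ← sumEigenvaluesRpow_conj hq0 hU P, ← sumEigenvaluesRpow_conj hq0 hU Q]
  refine le_trans ?_ (mul_le_mul_of_nonneg_left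
    (add_le_add (hP'.sum_diag_rpow_le hq) (hQ'.sum_diag_rpow_le hq)) (by positivity))
  rw [← Finset.sum_add_distrib, Finset.mul_sum]
  refine Finset.sum_le_sum fun i _ => ?_
  have ha : 0 ≤ ((Uᴴ * P * U) i i).re := (Complex.le_def.1 (hP'.diag_nonneg (i := i))).1
  have hb : 0 ≤ ((Uᴴ * Q * U) i i).re := (Complex.le_def.1 (hQ'.diag_nonneg (i := i))).1
  have hsum : ((Uᴴ * (2 • (P + Q)) * U) i i).re =
      2 * (((Uᴴ * P * U) i i).re + ((Uᴴ * Q * U) i i).re) := by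
    simp only [two_nsmul, Matrix.mul_add, Matrix.add_mul, add_apply, Complex.add_re]
    ring
  rw [hsum, Real.mul_rpow zero_le_two (add_nonneg ha hb), two_mul q, add_sub_assoc,
    Real.rpow_add zero_lt_two, mul_assoc ((2 : ℝ) ^ q)]
  refine mul_le_mul_of_nonneg_left ?_ (Real.rpow_nonneg zero_le_two q)
  lift ((Uᴴ * P * U) i i).re to NNReal using ha with a
  lift ((Uᴴ * Q * U) i i).re to NNReal using hb with b
  exact_mod_cast NNReal.rpow_add_le_mul_rpow_add_rpow a b hq

end Matrix

theorem schattenNorm_rpow_self {m : Type*} [Fintype m] [DecidableEq m] {p : ℝ} (hp : p ≠ 0)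
    (X : Matrix m m ℂ) :
    schattenNorm p X ^ p = Matrix.sumEigenvaluesRpow (p / 2) (X.conjTranspose * X) := by
  have hX := Matrix.posSemidef_conjTranspose_mul_self X
  rw [schattenNorm, hX.1.sumEigenvaluesRpow_eq, one_div, Real.rpow_inv_rpow _ hp]
  exact Finset.sum_nonneg fun i _ => Real.rpow_nonneg (hX.eigenvalues_nonneg i) _

theorem clarkson_second_upper {m : Type*} [Fintype m] [DecidableEq m]
    (A B : Matrix m m ℂ) (p : ℝ) (hp : 2 ≤ p) :
    schattenNorm p (A + B) ^ p + schattenNorm p (A - B) ^ p ≤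
      (2 : ℝ) ^ (p - 1) * (schattenNorm p A ^ p + schattenNorm p B ^ p) := by
  have hp0 : p ≠ 0 := by positivity
  have hq : 1 ≤ p / 2 := by linarith
  have hparallelogram : (A + B).conjTranspose * (A + B) + (A - B).conjTranspose * (A - B) =
      2 • (A.conjTranspose * A + B.conjTranspose * B) := by
    rw [Matrix.conjTranspose_add, Matrix.conjTranspose_sub]
    noncomm_ring
  simp only [schattenNorm_rpow_self hp0]
  refine (Matrix.sumEigenvaluesRpow_add_le hq _ _).trans ?_
  rw [hparallelogram]
  have h := Matrix.sumEigenvaluesRpow_two_nsmul_add_le hq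
    (Matrix.posSemidef_conjTranspose_mul_self A) (Matrix.posSemidef_conjTranspose_mul_self B)
  rwa [mul_div_cancel₀ p two_ne_zero] at h
end

section
/- (Optimal 2-uniform convexity, Ball–Carlen–Lieb) For complex square matrices A, B and 1 ≤ p ≤ 2: ((‖A+B‖_p^p + ‖A−B‖_p^p)/2)^(2/p) ≥ ‖A‖_p^2 + (p−1)·‖B‖_p^2. -/
open scoped ComplexOrder

open Matrix

/-- The Hermitian matrix `U diag(x) Uᴴ`. -/
noncomputable def conjDiag {n : Type*} [Fintype n] [DecidableEq n]
    (U : Matrix n n ℂ) (x : n → ℝ) : Matrix n n ℂ :=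
  U * diagonal (fun i => (x i : ℂ)) * Uᴴ

section Trace

variable {n : Type*} [Fintype n] [DecidableEq n]

lemma re_trace_conjDiag_mul_conjDiag (E U V : Matrix n n ℂ) (s t : n → ℝ) :
    (trace (Eᴴ * conjDiag U s * E * conjDiag V t)).re =
      ∑ i, ∑ j, s i * t j * Complex.normSq ((Uᴴ * E * V) i j) := by
  set F := Uᴴ * E * V with hF
  have h1 : trace (Eᴴ * conjDiag U s * E * conjDiag V t) =
      trace (Fᴴ * diagonal (fun i => (s i : ℂ)) * F * diagonal (fun i => (t i : ℂ))) := by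
    have : Eᴴ * conjDiag U s * E * conjDiag V t =
        (Eᴴ * U * diagonal (fun i => (s i : ℂ)) * Uᴴ * E * V *
          diagonal (fun i => (t i : ℂ))) * Vᴴ := by
      simp only [conjDiag, Matrix.mul_assoc]
    rw [this, trace_mul_comm]
    simp only [hF, conjTranspose_mul, conjTranspose_conjTranspose, Matrix.mul_assoc]
  rw [h1, trace, Complex.re_sum, Finset.sum_comm]
  refine Finset.sum_congr rfl fun j _ => ?_
  rw [diag_apply, mul_diagonal, mul_apply, Finset.sum_mul, Complex.re_sum]
  refine Finset.sum_congr rfl fun i _ => ?_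
  rw [mul_diagonal, conjTranspose_apply, Complex.normSq_apply]
  simp
  ring

lemma conjDiag_one_fun {U : Matrix n n ℂ} (hU : U ∈ unitaryGroup n ℂ) :
    conjDiag U (fun _ => 1) = 1 := by
  have : diagonal (fun _ : n => ((1 : ℝ) : ℂ)) = 1 := by simp
  rw [conjDiag, this, Matrix.mul_one]
  exact mem_unitaryGroup_iff.1 hU

lemma conjDiag_mul_conjDiag {U : Matrix n n ℂ} (hU : U ∈ unitaryGroup n ℂ) (x y : n → ℝ) :
    conjDiag U x * conjDiag U y = conjDiag U (fun i => x i * y i) := by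
  have h : Uᴴ * U = 1 := mem_unitaryGroup_iff'.1 hU
  have h2 : diagonal (fun i => ((x i * y i : ℝ) : ℂ)) =
      diagonal (fun i => (x i : ℂ)) * diagonal (fun i => (y i : ℂ)) := by simp
  simp only [conjDiag, h2, Matrix.mul_assoc]
  rw [← Matrix.mul_assoc Uᴴ U, h, Matrix.one_mul]

lemma conjDiag_inv {U : Matrix n n ℂ} (hU : U ∈ unitaryGroup n ℂ) {x : n → ℝ} (hx : ∀ i, x i ≠ 0) :
    (conjDiag U x)⁻¹ = conjDiag U (fun i => (x i)⁻¹) := by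
  apply inv_eq_right_inv
  rw [conjDiag_mul_conjDiag hU]
  simp only [mul_inv_cancel₀ (hx _)]
  exact conjDiag_one_fun hU

lemma Matrix.IsHermitian.exists_conjDiag {A : Matrix n n ℂ} (hA : A.IsHermitian) :
    ∃ U ∈ unitaryGroup n ℂ, conjDiag U hA.eigenvalues = A := by
  refine ⟨_, hA.eigenvectorUnitary.2, ?_⟩
  conv_rhs => rw [hA.spectral_theorem]
  rfl

lemma conjDiag_posDef {U : Matrix n n ℂ} (hU : U ∈ unitaryGroup n ℂ) {x : n → ℝ}
    (hx : ∀ i, 0 < x i) : (conjDiag U x).PosDef := by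
  have h : Uᴴ * U = 1 := mem_unitaryGroup_iff'.1 hU
  have h0 : (diagonal (fun i => (x i : ℂ))).PosDef :=
    PosDef.diagonal fun i => by simpa using hx i
  refine h0.mul_mul_conjTranspose_same ?_
  intro v w hvw
  have := congrArg (fun z => z ᵥ* Uᴴ) hvw
  have h' : U * Uᴴ = 1 := mem_unitaryGroup_iff.1 hU
  simpa [vecMul_vecMul, h'] using this

lemma three_le_inv_mul_inv_add_add {a b : ℝ} (ha : 0 < a) (hb : 0 < b) :
    3 ≤ a⁻¹ * b⁻¹ + a + b := by
  have h : a * b * (3 - (a + b)) ≤ 1 := by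
    rcases le_total 3 (a + b) with h3 | h3
    · nlinarith [mul_pos ha hb]
    · nlinarith [mul_nonneg (sub_nonneg.2 h3) (sq_nonneg (a - b)),
        mul_nonneg (sq_nonneg (a + b - 2)) (add_pos ha hb).le, sq_nonneg (a + b - 2)]
  have h' : a⁻¹ * b⁻¹ * (a * b * (3 - (a + b))) ≤ a⁻¹ * b⁻¹ * 1 :=
    mul_le_mul_of_nonneg_left h (by positivity)
  have e : a⁻¹ * b⁻¹ * (a * b * (3 - (a + b))) = 3 - (a + b) := by field_simp
  linarith

lemma three_mul_re_trace_le {A B : Matrix n n ℂ} (hA : A.PosDef) (hB : B.PosDef)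
    (E : Matrix n n ℂ) :
    3 * (trace (Eᴴ * E)).re ≤ (trace (Eᴴ * A⁻¹ * E * B⁻¹)).re + (trace (Eᴴ * A * E)).re +
      (trace (Eᴴ * E * B)).re := by
  obtain ⟨U, hU, eA⟩ := hA.1.exists_conjDiag
  obtain ⟨V, hV, eB⟩ := hB.1.exists_conjDiag
  have pa := hA.eigenvalues_pos
  have pb := hB.eigenvalues_pos
  set a := hA.1.eigenvalues
  set b := hB.1.eigenvalues
  have t0 := re_trace_conjDiag_mul_conjDiag E U V (fun _ => 1) (fun _ => 1)
  have t1 := re_trace_conjDiag_mul_conjDiag E U V (fun i => (a i)⁻¹) (fun i => (b i)⁻¹)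
  have t2 := re_trace_conjDiag_mul_conjDiag E U V a (fun _ => 1)
  have t3 := re_trace_conjDiag_mul_conjDiag E U V (fun _ => 1) b
  rw [conjDiag_one_fun hU, conjDiag_one_fun hV, Matrix.mul_one, Matrix.mul_one] at t0
  rw [← conjDiag_inv hU fun i => (pa i).ne', ← conjDiag_inv hV fun i => (pb i).ne', eA, eB] at t1
  rw [eA, conjDiag_one_fun hV, Matrix.mul_one] at t2
  rw [eB, conjDiag_one_fun hU, Matrix.mul_one] at t3
  rw [t0, t1, t2, t3, Finset.mul_sum, ← Finset.sum_add_distrib, ← Finset.sum_add_distrib]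
  refine Finset.sum_le_sum fun i _ => ?_
  rw [Finset.mul_sum, ← Finset.sum_add_distrib, ← Finset.sum_add_distrib]
  refine Finset.sum_le_sum fun j _ => ?_
  have := mul_le_mul_of_nonneg_right (three_le_inv_mul_inv_add_add (pa i) (pb j))
    (Complex.normSq_nonneg ((Uᴴ * E * V) i j))
  linarith

lemma sum_sq_div_sq_le_re_trace {A B : Matrix n n ℂ} (hA : A.PosDef) (hB : B.PosDef)
    (d γ : n → ℝ) (hγ : ∀ k, 0 < γ k) (hAB : ∀ k, 2 * γ k = (A k k).re + (B k k).re) :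
    ∑ k, d k ^ 2 / γ k ^ 2 ≤
      (trace ((diagonal fun k => (d k : ℂ))ᴴ * A⁻¹ * (diagonal fun k => (d k : ℂ)) * B⁻¹)).re := by
  set G : Matrix n n ℂ := diagonal fun k => ((√(γ k) : ℝ) : ℂ) with hG
  set G' : Matrix n n ℂ := diagonal fun k => ((√(γ k))⁻¹ : ℂ) with hG'
  set E : Matrix n n ℂ := diagonal fun k => ((d k / γ k : ℝ) : ℂ) with hE
  set D : Matrix n n ℂ := diagonal fun k => (d k : ℂ) with hD
  have hs : ∀ k, (√(γ k) : ℂ) ≠ 0 := fun k => by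
    exact_mod_cast (Real.sqrt_pos.2 (hγ k)).ne'
  have hss : ∀ k, (√(γ k) : ℂ) * (√(γ k) : ℂ) = γ k := fun k => by
    exact_mod_cast Real.mul_self_sqrt (hγ k).le
  have hGG' : G * G' = 1 := by simp [hG, hG', hs]
  have hG'G : G' * G = 1 := by simp [hG, hG', hs]
  have hG'H : G'ᴴ = G' := by simp [hG', diagonal_conjTranspose, Pi.star_def]
  have hEH : Eᴴ = E := by simp [hE, diagonal_conjTranspose, Pi.star_def]
  have hDH : Dᴴ = D := by simp [hD, diagonal_conjTranspose, Pi.star_def]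
  have hGEG : G * E * G = D := by
    simp only [hG, hE, hD, diagonal_mul_diagonal]
    congr 1
    ext k
    rw [mul_right_comm, hss, ← Complex.ofReal_mul, mul_div_cancel₀ _ (hγ k).ne']
  have hinj : Function.Injective G'.vecMul := by
    intro v w hvw
    have := congrArg (fun z => z ᵥ* G) hvw
    simpa [vecMul_vecMul, hG'G] using this
  have pd : ∀ M : Matrix n n ℂ, M.PosDef → (G' * M * G').PosDef := by
    intro M hM
    have := hM.mul_mul_conjTranspose_same (B := G') hinj
    rwa [hG'H] at this
  have iv : ∀ M : Matrix n n ℂ, M.PosDef → (G' * M * G')⁻¹ = G * M⁻¹ * G := by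
    intro M hM
    have hu : IsUnit M.det := (isUnit_iff_isUnit_det M).1 hM.isUnit
    apply inv_eq_right_inv
    calc G' * M * G' * (G * M⁻¹ * G) = G' * M * (G' * G) * M⁻¹ * G := by
          simp only [Matrix.mul_assoc]
      _ = G' * (M * M⁻¹) * G := by rw [hG'G, Matrix.mul_one, Matrix.mul_assoc G']
      _ = 1 := by rw [mul_nonsing_inv _ hu, Matrix.mul_one, hG'G]
  have key := three_mul_re_trace_le (pd A hA) (pd B hB) E
  rw [iv A hA, iv B hB, hEH] at key
  have e1 : trace (E * (G * A⁻¹ * G) * E * (G * B⁻¹ * G)) = trace (D * A⁻¹ * D * B⁻¹) := by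
    rw [← hGEG]
    have : E * (G * A⁻¹ * G) * E * (G * B⁻¹ * G) =
      (E * G * A⁻¹ * (G * E * G) * B⁻¹) * G := by simp only [Matrix.mul_assoc]
    rw [this, trace_mul_comm]
    simp only [Matrix.mul_assoc]
  have hdiag : ∀ M : Matrix n n ℂ, ∀ k, (G' * M * G') k k = M k k / γ k := by
    intro M k
    rw [hG', mul_diagonal, diagonal_mul, ← hss]
    field_simp
  have e2 : (trace (E * (G' * A * G') * E)).re = ∑ k, (d k / γ k) ^ 2 * ((A k k).re / γ k) := by
    rw [trace, Complex.re_sum]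
    refine Finset.sum_congr rfl fun k _ => ?_
    rw [diag_apply, hE, mul_diagonal, diagonal_mul, hdiag]
    rw [mul_comm, ← mul_assoc, ← Complex.ofReal_mul, Complex.re_ofReal_mul, Complex.div_ofReal_re]
    ring
  have e3 : (trace (E * E * (G' * B * G'))).re = ∑ k, (d k / γ k) ^ 2 * ((B k k).re / γ k) := by
    rw [trace, Complex.re_sum]
    refine Finset.sum_congr rfl fun k _ => ?_
    rw [diag_apply, hE, diagonal_mul_diagonal, diagonal_mul, hdiag]
    rw [← Complex.ofReal_mul, Complex.re_ofReal_mul, Complex.div_ofReal_re]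
    ring
  have e0 : (trace (E * E)).re = ∑ k, (d k / γ k) ^ 2 := by
    rw [trace, Complex.re_sum]
    refine Finset.sum_congr rfl fun k _ => ?_
    rw [diag_apply, hE, diagonal_mul_diagonal, diagonal_apply_eq, ← Complex.ofReal_mul,
      Complex.ofReal_re]
    ring
  rw [e0, e1, e2, e3, add_assoc, ← Finset.sum_add_distrib] at key
  have e4 : ∑ k, ((d k / γ k) ^ 2 * ((A k k).re / γ k) + (d k / γ k) ^ 2 * ((B k k).re / γ k)) =
      2 * ∑ k, (d k / γ k) ^ 2 := by
    rw [Finset.mul_sum]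
    refine Finset.sum_congr rfl fun k _ => ?_
    rw [← mul_add, ← add_div, ← hAB, mul_div_assoc, div_self (hγ k).ne']
    ring
  rw [e4] at key
  rw [hDH]
  simp only [← div_pow]
  linarith

end Trace

/-- The odd function equal to `x ^ a` for `0 ≤ x`. -/
noncomputable def oddRpow (a x : ℝ) : ℝ := SignType.sign x * |x| ^ a

section Scalar

lemma mul_mul_rpow_sub_one_le {a c c' : ℝ} (ha : 0 ≤ a) (ha1 : a ≤ 1) (hc : 0 ≤ c)
    (hc' : 0 < c') : a * c' ^ (a - 1) * (c' - c) ≤ c' ^ a - c ^ a := by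
  have h := rpow_one_add_le_one_add_mul_self (s := c / c' - 1)
    (by have : 0 ≤ c / c' := by positivity
        linarith) ha ha1
  rw [add_sub_cancel, Real.div_rpow hc hc'.le, div_le_iff₀ (by positivity)] at h
  rw [Real.rpow_sub_one hc'.ne']
  have e : (1 + a * (c / c' - 1)) * c' ^ a = c' ^ a - a * (c' ^ a / c') * (c' - c) := by
    field_simp
    ring
  linarith

lemma rpowIntegrand_sub {a t c c' : ℝ} (ht : 0 < t) (hc : 0 ≤ c) (hc' : 0 ≤ c') :
    Real.rpowIntegrand₀₁ a t c' - Real.rpowIntegrand₀₁ a t c =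
      t ^ a * ((c' - c) / ((c + t) * (c' + t))) := by
  have h1 : t + c ≠ 0 := by positivity
  have h2 : t + c' ≠ 0 := by positivity
  rw [Real.rpowIntegrand₀₁, Real.rpowIntegrand₀₁, add_comm c t, add_comm c' t]
  field_simp
  ring

lemma sq_sub_mul_inv_le {a t x y : ℝ} (ht : 0 < t) :
    t ^ a * ((|x| + t)⁻¹ * (|y| + t)⁻¹ * (x - y) ^ 2) ≤
      (x - y) * (SignType.sign x * Real.rpowIntegrand₀₁ a t |x| -
        SignType.sign y * Real.rpowIntegrand₀₁ a t |y|) := by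
  have h : ∀ z : ℝ, SignType.sign z * Real.rpowIntegrand₀₁ a t |z| =
      t ^ a * t⁻¹ * (z / (|z| + t)) := by
    intro z
    have h1 : t + |z| ≠ 0 := by positivity
    have : (SignType.sign z : ℝ) * Real.rpowIntegrand₀₁ a t |z| =
      t ^ a * t⁻¹ * ((SignType.sign z * |z|) / (|z| + t)) := by
      rw [Real.rpowIntegrand₀₁, add_comm |z|]
      field_simp
      ring
    rw [this, sign_mul_abs]
  rw [h, h, ← mul_sub, mul_left_comm (x - y), mul_assoc (t ^ a) t⁻¹]
  refine mul_le_mul_of_nonneg_left ?_ (Real.rpow_nonneg ht.le a)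
  have hx : 0 < |x| + t := by positivity
  have hy : 0 < |y| + t := by positivity
  have key : t * (x - y) ^ 2 ≤ (x - y) * (x * (|y| + t) - y * (|x| + t)) := by
    have : 0 ≤ (x - y) * (x * |y| - y * |x|) := by
      have hxy : x * y ≤ |x| * |y| := by
        rw [← abs_mul]
        exact le_abs_self _
      have := mul_nonneg (sub_nonneg.2 hxy) (add_nonneg (abs_nonneg x) (abs_nonneg y))
      nlinarith [sq_abs x, sq_abs y]
    nlinarith
  have e : t⁻¹ * ((x - y) * (x / (|x| + t) - y / (|y| + t))) =
      t⁻¹ * ((x - y) * (x * (|y| + t) - y * (|x| + t))) * ((|x| + t)⁻¹ * (|y| + t)⁻¹) := by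
    field_simp
  have e2 : (|x| + t)⁻¹ * (|y| + t)⁻¹ * (x - y) ^ 2 =
      t⁻¹ * (t * (x - y) ^ 2) * ((|x| + t)⁻¹ * (|y| + t)⁻¹) := by
    field_simp
  rw [e, e2]
  gcongr

lemma rpow_sum_rpow_le {n : Type*} [Fintype n] {p : ℝ} (hp1 : 1 < p) (hp2 : p < 2)
    (d c : n → ℝ) (hc : ∀ k, 0 < c k) :
    (∑ k, |d k| ^ p) ^ (2 / p) ≤
      (∑ k, d k ^ 2 * c k ^ (p - 2)) * (∑ k, c k ^ p) ^ ((2 - p) / p) := by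
  have hp0 : 0 < p := by linarith
  have h2p : 0 < 2 - p := by linarith
  have hpq : (2 / p).HolderConjugate (2 / (2 - p)) := by
    rw [Real.holderConjugate_iff]
    refine ⟨by rw [lt_div_iff₀ hp0]; linarith, ?_⟩
    field_simp
    ring
  have h := Real.inner_le_Lp_mul_Lq_of_nonneg Finset.univ hpq
    (f := fun k => (d k ^ 2 * c k ^ (p - 2)) ^ (p / 2)) (g := fun k => (c k ^ p) ^ ((2 - p) / 2))
    (fun k _ => by have := hc k; positivity) (fun k _ => by have := hc k; positivity)
  have e1 : ∀ k, (d k ^ 2 * c k ^ (p - 2)) ^ (p / 2) * (c k ^ p) ^ ((2 - p) / 2) = |d k| ^ p := by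
    intro k
    have := hc k
    rw [Real.mul_rpow (by positivity) (by positivity), ← Real.rpow_mul this.le,
      ← Real.rpow_mul this.le, mul_assoc, ← Real.rpow_add this, ← sq_abs, ← Real.rpow_natCast,
      ← Real.rpow_mul (abs_nonneg _)]
    have a1 : (p - 2) * (p / 2) + p * ((2 - p) / 2) = 0 := by ring
    have a2 : ((2 : ℕ) : ℝ) * (p / 2) = p := by push_cast; ring
    rw [a1, a2, Real.rpow_zero, mul_one]
  have e2 : ∀ k, ((d k ^ 2 * c k ^ (p - 2)) ^ (p / 2)) ^ (2 / p) = d k ^ 2 * c k ^ (p - 2) := by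
    intro k
    have := hc k
    rw [← Real.rpow_mul (by positivity)]
    have : p / 2 * (2 / p) = 1 := by field_simp
    rw [this, Real.rpow_one]
  have e3 : ∀ k, ((c k ^ p) ^ ((2 - p) / 2)) ^ (2 / (2 - p)) = c k ^ p := by
    intro k
    have := hc k
    rw [← Real.rpow_mul (by positivity)]
    have : (2 - p) / 2 * (2 / (2 - p)) = 1 := by field_simp
    rw [this, Real.rpow_one]
  simp only [e1, e2, e3] at h
  have s1 : 0 ≤ ∑ k, d k ^ 2 * c k ^ (p - 2) :=
    Finset.sum_nonneg fun k _ => by have := hc k; positivity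
  have s2 : 0 ≤ ∑ k, c k ^ p := Finset.sum_nonneg fun k _ => by have := hc k; positivity
  have s3 : 0 ≤ ∑ k, |d k| ^ p := Finset.sum_nonneg fun k _ => by positivity
  refine (Real.rpow_le_rpow s3 h (by positivity)).trans_eq ?_
  rw [Real.mul_rpow (by positivity) (by positivity), ← Real.rpow_mul s1, ← Real.rpow_mul s2]
  have a1 : 1 / (2 / p) * (2 / p) = 1 := by field_simp
  have a2 : 1 / (2 / (2 - p)) * (2 / p) = (2 - p) / p := by field_simp
  rw [a1, a2, Real.rpow_one]

end Scalar

/-- The diagonal entries of `(U diag|x| Uᴴ + V diag|y| Vᴴ) / 2`. -/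
noncomputable def meanAbsDiag {n : Type*} [Fintype n]
    (U V : Matrix n n ℂ) (x y : n → ℝ) (k : n) : ℝ :=
  (∑ i, |x i| * Complex.normSq (U k i) + ∑ i, |y i| * Complex.normSq (V k i)) / 2

lemma meanAbsDiag_nonneg {n : Type*} [Fintype n] (U V : Matrix n n ℂ) (x y : n → ℝ) (k : n) :
    0 ≤ meanAbsDiag U V x y k := by
  have h : ∀ (W : Matrix n n ℂ) (z : n → ℝ), 0 ≤ ∑ i, |z i| * Complex.normSq (W k i) :=
    fun W z => Finset.sum_nonneg fun i _ => mul_nonneg (abs_nonneg _) (Complex.normSq_nonneg _)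
  have := h U x
  have := h V y
  unfold meanAbsDiag
  positivity

section Overlap

variable {n : Type*} [Fintype n] [DecidableEq n]

lemma conjDiag_apply_self_re (U : Matrix n n ℂ) (a : n → ℝ) (k : n) :
    (conjDiag U a k k).re = ∑ i, a i * Complex.normSq (U k i) := by
  rw [conjDiag, mul_apply, Complex.re_sum]
  refine Finset.sum_congr rfl fun i _ => ?_
  rw [mul_diagonal, conjTranspose_apply, Complex.normSq_apply]
  simp
  ring

lemma sum_normSq_row {U : Matrix n n ℂ} (hU : U ∈ unitaryGroup n ℂ) (k : n) :
    ∑ i, Complex.normSq (U k i) = 1 := by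
  have h := conjDiag_apply_self_re U (fun _ => 1) k
  rw [conjDiag_one_fun hU] at h
  simpa using h.symm

lemma sum_normSq_col {U : Matrix n n ℂ} (hU : U ∈ unitaryGroup n ℂ) (i : n) :
    ∑ k, Complex.normSq (U k i) = 1 := by
  have h : Uᴴ ∈ unitaryGroup n ℂ := Unitary.star_mem hU
  simpa using sum_normSq_row h i

lemma sum_rpow_meanAbsDiag_le {U V : Matrix n n ℂ} (hU : U ∈ unitaryGroup n ℂ)
    (hV : V ∈ unitaryGroup n ℂ) (x y : n → ℝ) {p : ℝ} (hp : 1 ≤ p) :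
    ∑ k, meanAbsDiag U V x y k ^ p ≤ (∑ i, |x i| ^ p + ∑ i, |y i| ^ p) / 2 := by
  have h1 : ∀ {W : Matrix n n ℂ}, W ∈ unitaryGroup n ℂ → ∀ (z : n → ℝ),
      ∑ k, (∑ i, |z i| * Complex.normSq (W k i)) ^ p ≤ ∑ i, |z i| ^ p := by
    intro W hW z
    calc ∑ k, (∑ i, |z i| * Complex.normSq (W k i)) ^ p
        ≤ ∑ k, ∑ i, Complex.normSq (W k i) * |z i| ^ p := by
          refine Finset.sum_le_sum fun k _ => ?_
          simp only [mul_comm |z _|]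
          exact Real.rpow_arith_mean_le_arith_mean_rpow _ _ _ (fun i _ => Complex.normSq_nonneg _)
            (sum_normSq_row hW k) (fun i _ => abs_nonneg _) hp
      _ = ∑ i, |z i| ^ p := by
          rw [Finset.sum_comm]
          refine Finset.sum_congr rfl fun i _ => ?_
          rw [← Finset.sum_mul, sum_normSq_col hW, one_mul]
  have h2 : ∀ k, meanAbsDiag U V x y k ^ p ≤ ((∑ i, |x i| * Complex.normSq (U k i)) ^ p +
      (∑ i, |y i| * Complex.normSq (V k i)) ^ p) / 2 := by
    intro k
    have h0 : ∀ (W : Matrix n n ℂ) (z : n → ℝ) (k : n), 0 ≤ ∑ i, |z i| * Complex.normSq (W k i) :=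
      fun W z k => Finset.sum_nonneg fun i _ => mul_nonneg (abs_nonneg _) (Complex.normSq_nonneg _)
    obtain ⟨-, hconv⟩ := convexOn_rpow hp
    have := hconv (h0 U x k) (h0 V y k) (a := (1 / 2 : ℝ)) (b := (1 / 2 : ℝ))
      (by norm_num) (by norm_num) (by norm_num)
    simp only [smul_eq_mul] at this
    rw [meanAbsDiag, add_div, add_div, div_eq_inv_mul, div_eq_inv_mul, div_eq_inv_mul,
      div_eq_inv_mul]
    simpa using this
  calc ∑ k, meanAbsDiag U V x y k ^ p ≤ _ := Finset.sum_le_sum fun k _ => h2 k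
    _ ≤ _ := by
      rw [← Finset.sum_div, Finset.sum_add_distrib]
      have := h1 hU x
      have := h1 hV y
      linarith

variable {U V : Matrix n n ℂ} {x y d : n → ℝ}

lemma normSq_conj_diagonal (hU : U ∈ unitaryGroup n ℂ) (hV : V ∈ unitaryGroup n ℂ)
    (h : diagonal (fun k => (d k : ℂ)) = conjDiag U x - conjDiag V y) (i j : n) :
    Complex.normSq ((Uᴴ * diagonal (fun k => (d k : ℂ)) * V) i j) =
      (x i - y j) ^ 2 * Complex.normSq ((Uᴴ * V) i j) := by
  have hU' : Uᴴ * U = 1 := mem_unitaryGroup_iff'.1 hU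
  have hV' : Vᴴ * V = 1 := mem_unitaryGroup_iff'.1 hV
  have e : Uᴴ * diagonal (fun k => (d k : ℂ)) * V =
      diagonal (fun k => (x k : ℂ)) * (Uᴴ * V) - (Uᴴ * V) * diagonal (fun k => (y k : ℂ)) := by
    rw [h, conjDiag, conjDiag, Matrix.mul_sub, Matrix.sub_mul]
    congr 1
    · simp only [← Matrix.mul_assoc, hU', Matrix.one_mul]
    · simp only [Matrix.mul_assoc, hV', Matrix.mul_one]
  rw [e, Matrix.sub_apply, diagonal_mul, mul_diagonal, mul_comm _ (y j : ℂ), ← sub_mul, map_mul,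
    ← Complex.ofReal_sub, Complex.normSq_ofReal]
  ring

lemma sum_sq_div_meanAbsDiag_le (hU : U ∈ unitaryGroup n ℂ) (hV : V ∈ unitaryGroup n ℂ)
    (h : diagonal (fun k => (d k : ℂ)) = conjDiag U x - conjDiag V y) {t : ℝ} (ht : 0 < t) :
    ∑ k, d k ^ 2 / (meanAbsDiag U V x y k + t) ^ 2 ≤
      ∑ i, ∑ j, (|x i| + t)⁻¹ * (|y j| + t)⁻¹ * (x i - y j) ^ 2 *
        Complex.normSq ((Uᴴ * V) i j) := by
  have px : ∀ i, 0 < |x i| + t := fun i => by positivity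
  have py : ∀ i, 0 < |y i| + t := fun i => by positivity
  have key := sum_sq_div_sq_le_re_trace (conjDiag_posDef hU px) (conjDiag_posDef hV py) d
    (fun k => meanAbsDiag U V x y k + t)
    (fun k => add_pos_of_nonneg_of_pos (meanAbsDiag_nonneg U V x y k) ht) (fun k => by
      rw [conjDiag_apply_self_re, conjDiag_apply_self_re, meanAbsDiag]
      simp only [add_mul, Finset.sum_add_distrib, ← Finset.mul_sum, sum_normSq_row hU,
        sum_normSq_row hV]
      ring)
  rw [conjDiag_inv hU fun i => (px i).ne', conjDiag_inv hV fun i => (py i).ne',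
    re_trace_conjDiag_mul_conjDiag] at key
  simp only [normSq_conj_diagonal hU hV h] at key
  simpa only [mul_assoc] using key

open MeasureTheory Set in
lemma sum_sq_mul_rpow_le {p : ℝ} (hp1 : 1 < p) (hp2 : p < 2)
    (hU : U ∈ unitaryGroup n ℂ) (hV : V ∈ unitaryGroup n ℂ)
    (h : diagonal (fun k => (d k : ℂ)) = conjDiag U x - conjDiag V y)
    {c : n → ℝ} (hc : ∀ k, meanAbsDiag U V x y k < c k) :
    (p - 1) * ∑ k, d k ^ 2 * c k ^ (p - 2) ≤
      ∑ i, ∑ j, (x i - y j) * (oddRpow (p - 1) (x i) - oddRpow (p - 1) (y j)) *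
        Complex.normSq ((Uᴴ * V) i j) := by
  set m := meanAbsDiag U V x y with hm
  have hm0 : ∀ k, 0 ≤ m k := meanAbsDiag_nonneg U V x y
  have hc0 : ∀ k, 0 < c k := fun k => (hm0 k).trans_lt (hc k)
  obtain ⟨μ, hμ⟩ := Real.exists_measure_rpow_eq_integral_rpowIntegrand₀₁ (p := p - 1)
    ⟨by linarith, by linarith⟩
  have hi : ∀ z, 0 ≤ z → IntegrableOn (fun t => Real.rpowIntegrand₀₁ (p - 1) t z) (Ioi 0) μ :=
    fun z hz => (hμ z hz).1
  have hv : ∀ z, 0 ≤ z → z ^ (p - 1) = ∫ t in Ioi 0, Real.rpowIntegrand₀₁ (p - 1) t z ∂μ :=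
    fun z hz => (hμ z hz).2
  have I1 : ∀ k, IntegrableOn (fun t => d k ^ 2 / (c k - m k) *
      (Real.rpowIntegrand₀₁ (p - 1) t (c k) - Real.rpowIntegrand₀₁ (p - 1) t (m k))) (Ioi 0) μ :=
    fun k => ((hi _ (hc0 k).le).sub (hi _ (hm0 k))).const_mul _
  have I2 : ∀ i j, IntegrableOn (fun t => (x i - y j) *
      (SignType.sign (x i) * Real.rpowIntegrand₀₁ (p - 1) t |x i| -
        SignType.sign (y j) * Real.rpowIntegrand₀₁ (p - 1) t |y j|) *
        Complex.normSq ((Uᴴ * V) i j)) (Ioi 0) μ :=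
    fun i j => ((((hi _ (abs_nonneg _)).const_mul _).sub
      ((hi _ (abs_nonneg _)).const_mul _)).const_mul _).mul_const _
  have mono := setIntegral_mono_on (integrable_finsetSum Finset.univ fun k _ => I1 k)
    (integrable_finsetSum Finset.univ fun i _ =>
      integrable_finsetSum Finset.univ fun j _ => I2 i j) measurableSet_Ioi (by
    intro t ht
    replace ht : 0 < t := ht
    calc ∑ k, d k ^ 2 / (c k - m k) *
          (Real.rpowIntegrand₀₁ (p - 1) t (c k) - Real.rpowIntegrand₀₁ (p - 1) t (m k))
        ≤ ∑ k, t ^ (p - 1) * (d k ^ 2 / (m k + t) ^ 2) := by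
          refine Finset.sum_le_sum fun k _ => ?_
          have h1 := hm0 k
          have h2 := hc k
          have h3 := hc0 k
          have h4 : 0 < c k - m k := sub_pos.2 h2
          rw [rpowIntegrand_sub ht h1 h3.le]
          have : d k ^ 2 / (c k - m k) * (t ^ (p - 1) * ((c k - m k) / ((m k + t) * (c k + t)))) =
              t ^ (p - 1) * (d k ^ 2 / ((m k + t) * (c k + t))) := by
            field_simp
          rw [this, sq (m k + t)]
          gcongr
      _ ≤ ∑ i, ∑ j, t ^ (p - 1) * ((|x i| + t)⁻¹ * (|y j| + t)⁻¹ * (x i - y j) ^ 2) *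
            Complex.normSq ((Uᴴ * V) i j) := by
          rw [← Finset.mul_sum]
          refine (mul_le_mul_of_nonneg_left (sum_sq_div_meanAbsDiag_le hU hV h ht)
            (by positivity)).trans_eq ?_
          simp only [Finset.mul_sum, mul_assoc]
      _ ≤ _ := by
          refine Finset.sum_le_sum fun i _ => Finset.sum_le_sum fun j _ => ?_
          exact mul_le_mul_of_nonneg_right (sq_sub_mul_inv_le ht) (Complex.normSq_nonneg _))
  rw [integral_finsetSum _ fun k _ => I1 k, integral_finsetSum _ fun i _ =>
      integrable_finsetSum Finset.univ fun j _ => I2 i j] at mono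
  have E1 : ∀ k, ∫ t in Ioi 0, d k ^ 2 / (c k - m k) *
      (Real.rpowIntegrand₀₁ (p - 1) t (c k) - Real.rpowIntegrand₀₁ (p - 1) t (m k)) ∂μ =
      d k ^ 2 / (c k - m k) * (c k ^ (p - 1) - m k ^ (p - 1)) := by
    intro k
    rw [integral_const_mul, integral_sub (hi _ (hc0 k).le) (hi _ (hm0 k)), ← hv _ (hc0 k).le,
      ← hv _ (hm0 k)]
  have E2 : ∀ i, ∫ t in Ioi 0, ∑ j, (x i - y j) *
      (SignType.sign (x i) * Real.rpowIntegrand₀₁ (p - 1) t |x i| -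
        SignType.sign (y j) * Real.rpowIntegrand₀₁ (p - 1) t |y j|) *
        Complex.normSq ((Uᴴ * V) i j) ∂μ =
      ∑ j, (x i - y j) * (oddRpow (p - 1) (x i) - oddRpow (p - 1) (y j)) *
        Complex.normSq ((Uᴴ * V) i j) := by
    intro i
    rw [integral_finsetSum _ fun j _ => I2 i j]
    refine Finset.sum_congr rfl fun j _ => ?_
    rw [integral_mul_const, integral_const_mul, integral_sub ((hi _ (abs_nonneg _)).const_mul _)
      ((hi _ (abs_nonneg _)).const_mul _), integral_const_mul, integral_const_mul,
      ← hv _ (abs_nonneg _), ← hv _ (abs_nonneg _)]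
    rfl
  simp only [E1, E2] at mono
  refine le_trans ?_ mono
  rw [Finset.mul_sum]
  refine Finset.sum_le_sum fun k _ => ?_
  have h4 : 0 < c k - m k := sub_pos.2 (hc k)
  have := mul_mul_rpow_sub_one_le (a := p - 1) (by linarith) (by linarith) (hm0 k) (hc0 k)
  rw [show p - 1 - 1 = p - 2 by ring, ← le_div_iff₀ h4] at this
  calc (p - 1) * (d k ^ 2 * c k ^ (p - 2)) = d k ^ 2 * ((p - 1) * c k ^ (p - 2)) := by ring
    _ ≤ d k ^ 2 * ((c k ^ (p - 1) - m k ^ (p - 1)) / (c k - m k)) := by gcongr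
    _ = _ := by ring

lemma mul_rpow_sum_rpow_le_of_diagonal {p : ℝ} (hp1 : 1 < p) (hp2 : p < 2)
    (hU : U ∈ unitaryGroup n ℂ) (hV : V ∈ unitaryGroup n ℂ)
    (h : diagonal (fun k => (d k : ℂ)) = conjDiag U x - conjDiag V y) :
    (p - 1) * (∑ k, |d k| ^ p) ^ (2 / p) ≤
      (∑ i, ∑ j, (x i - y j) * (oddRpow (p - 1) (x i) - oddRpow (p - 1) (y j)) *
        Complex.normSq ((Uᴴ * V) i j)) *
      ((∑ i, |x i| ^ p + ∑ i, |y i| ^ p) / 2) ^ ((2 - p) / p) := by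
  set m := meanAbsDiag U V x y with hm
  have hm0 : ∀ k, 0 ≤ m k := meanAbsDiag_nonneg U V x y
  set W := ∑ i, ∑ j, (x i - y j) * (oddRpow (p - 1) (x i) - oddRpow (p - 1) (y j)) *
        Complex.normSq ((Uᴴ * V) i j) with hW
  have hp0 : 0 < p := by linarith
  have h2p : 0 < (2 - p) / p := div_pos (by linarith) hp0
  have step : ∀ ε : ℝ, 0 < ε → (p - 1) * (∑ k, |d k| ^ p) ^ (2 / p) ≤
      W * (∑ k, (m k + ε) ^ p) ^ ((2 - p) / p) := by
    intro ε hε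
    have pos : ∀ k, 0 < m k + ε := fun k => add_pos_of_nonneg_of_pos (hm0 k) hε
    have h1 := rpow_sum_rpow_le hp1 hp2 d (fun k => m k + ε) pos
    have h2 := sum_sq_mul_rpow_le hp1 hp2 hU hV h (c := fun k => m k + ε)
      (fun k => lt_add_of_pos_right _ hε)
    have h3 : 0 ≤ (∑ k, (m k + ε) ^ p) ^ ((2 - p) / p) :=
      Real.rpow_nonneg (Finset.sum_nonneg fun k _ => Real.rpow_nonneg (pos k).le _) _
    calc _ ≤ (p - 1) * ((∑ k, d k ^ 2 * (m k + ε) ^ (p - 2)) *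
          (∑ k, (m k + ε) ^ p) ^ ((2 - p) / p)) :=
          mul_le_mul_of_nonneg_left h1 (by linarith)
      _ ≤ _ := by
        rw [← mul_assoc]
        exact mul_le_mul_of_nonneg_right h2 h3
  have hcont : Continuous fun ε : ℝ => W * (∑ k, (m k + ε) ^ p) ^ ((2 - p) / p) := by
    refine continuous_const.mul (Continuous.rpow_const ?_ fun _ => Or.inr h2p.le)
    exact continuous_finsetSum _ fun k _ =>
      Continuous.rpow_const (by fun_prop) fun _ => Or.inr hp0.le
  have lim : (p - 1) * (∑ k, |d k| ^ p) ^ (2 / p) ≤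
      W * (∑ k, m k ^ p) ^ ((2 - p) / p) := by
    have := (hcont.tendsto 0).mono_left (nhdsWithin_le_nhds (s := Set.Ioi 0))
    simp only [add_zero] at this
    exact ge_of_tendsto this (Filter.eventually_of_mem self_mem_nhdsWithin step)
  have hW0 : 0 ≤ W := by
    have := sum_sq_mul_rpow_le hp1 hp2 hU hV h (c := fun k => m k + 1)
      (fun k => lt_add_of_pos_right _ one_pos)
    refine le_trans (mul_nonneg (by linarith) (Finset.sum_nonneg fun k _ => ?_)) this
    have := hm0 k
    positivity
  refine lim.trans (mul_le_mul_of_nonneg_left ?_ hW0)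
  exact Real.rpow_le_rpow (Finset.sum_nonneg fun k _ => Real.rpow_nonneg (hm0 k) _)
    (sum_rpow_meanAbsDiag_le hU hV x y hp1.le) h2p.le

end Overlap

/-- The `p`-th power of the Schatten `p`-norm, in terms of the roots of the characteristic
polynomial of `Mᴴ * M`. -/
noncomputable def schattenSum {n : Type*} [Fintype n] [DecidableEq n]
    (p : ℝ) (M : Matrix n n ℂ) : ℝ :=
  ((Mᴴ * M).charpoly.roots.map fun z => z.re ^ (p / 2)).sum

section ScalarConvexity

lemma mul_rpow_sub_one_mul_le {q a b : ℝ} (hq : 1 < q) (ha : 0 ≤ a) (hb : 0 ≤ b) :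
    q * a ^ (q - 1) * (b - a) ≤ b ^ q - a ^ q := by
  rcases ha.eq_or_lt with rfl | ha
  · rw [Real.zero_rpow (by linarith), Real.zero_rpow (by linarith)]
    have := Real.rpow_nonneg hb q
    linarith
  have h := one_add_mul_self_le_rpow_one_add (s := b / a - 1)
    (by have : 0 ≤ b / a := by positivity
        linarith) hq.le
  rw [add_sub_cancel, Real.div_rpow hb ha.le, le_div_iff₀ (by positivity)] at h
  rw [Real.rpow_sub_one ha.ne']
  have e : (1 + q * (b / a - 1)) * a ^ q = a ^ q + q * (a ^ q / a) * (b - a) := by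
    field_simp
  linarith

lemma oddRpow_mul_self {p : ℝ} (hp : 1 < p) (x : ℝ) : oddRpow (p - 1) x * x = |x| ^ p := by
  rcases eq_or_ne x 0 with rfl | hx
  · simp [oddRpow, Real.zero_rpow (by linarith : p ≠ 0)]
  rw [oddRpow, mul_right_comm, mul_comm (SignType.sign x : ℝ) x, self_mul_sign,
    Real.rpow_sub_one (abs_pos.2 hx).ne']
  have := abs_pos.2 hx
  field_simp

lemma abs_oddRpow_le (a x : ℝ) : |oddRpow a x| ≤ |x| ^ a := by
  have h := Real.rpow_nonneg (abs_nonneg x) a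
  rw [oddRpow, abs_mul, abs_of_nonneg h]
  refine mul_le_of_le_one_left h ?_
  rcases lt_trichotomy x 0 with hx | rfl | hx
  · simp [hx]
  · simp
  · simp [hx]

lemma mul_oddRpow_mul_sub_le {p : ℝ} (hp : 1 < p) (x y : ℝ) :
    p * (oddRpow (p - 1) x * (y - x)) ≤ |y| ^ p - |x| ^ p := by
  have h1 := mul_rpow_sub_one_mul_le hp (abs_nonneg x) (abs_nonneg y)
  have h2 : oddRpow (p - 1) x * y ≤ |x| ^ (p - 1) * |y| := by
    refine (le_abs_self _).trans ?_
    rw [abs_mul]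
    exact mul_le_mul_of_nonneg_right (abs_oddRpow_le _ _) (abs_nonneg _)
  have h3 : |x| ^ (p - 1) * |x| = |x| ^ p := by
    conv_lhs => rw [← Real.rpow_one |x|, ← Real.rpow_mul (abs_nonneg x), one_mul,
      ← Real.rpow_add' (abs_nonneg x) (by simp; linarith)]
    simp
  have h4 := oddRpow_mul_self hp x
  refine le_trans ?_ h1
  rw [mul_assoc]
  refine mul_le_mul_of_nonneg_left ?_ (by linarith)
  rw [mul_sub, mul_sub, h3, h4]
  linarith

lemma add_le_of_forall_mul_le_sub {g : ℝ → ℝ} {K : ℝ}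
    (h : ∀ r s, 0 ≤ r → r ≤ s → 2 * K * (r * (s - r)) ≤ g s - g r) : g 0 + K ≤ g 1 := by
  have step : ∀ n : ℕ, K * (1 - ((n : ℝ) + 1)⁻¹) ≤ g 1 - g 0 := by
    intro n
    have hn : (0 : ℝ) < (n : ℝ) + 1 := by positivity
    have ind : ∀ k : ℕ, K * ((k : ℝ) * (k - 1) / ((n : ℝ) + 1) ^ 2) ≤
        g (k / ((n : ℝ) + 1)) - g 0 := by
      intro k
      induction k with
      | zero => simp
      | succ k ih =>
        have h1 := h (k / ((n : ℝ) + 1)) ((k + 1 : ℕ) / ((n : ℝ) + 1)) (by positivity)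
          (by push_cast; gcongr; linarith)
        have e : K * (((k + 1 : ℕ) : ℝ) * ((k + 1 : ℕ) - 1) / ((n : ℝ) + 1) ^ 2) =
            K * ((k : ℝ) * (k - 1) / ((n : ℝ) + 1) ^ 2) +
            2 * K * (k / ((n : ℝ) + 1) * ((k + 1 : ℕ) / ((n : ℝ) + 1) - k / ((n : ℝ) + 1))) := by
          push_cast
          field_simp
          ring
        rw [e]
        linarith
    have h2 := ind (n + 1)
    have e1 : (((n + 1 : ℕ) : ℝ)) / ((n : ℝ) + 1) = 1 := by
      push_cast
      exact div_self hn.ne'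
    have e2 : ((n + 1 : ℕ) : ℝ) * ((n + 1 : ℕ) - 1) / ((n : ℝ) + 1) ^ 2 = 1 - ((n : ℝ) + 1)⁻¹ := by
      push_cast
      field_simp
    rwa [e1, e2] at h2
  have lim : Filter.Tendsto (fun n : ℕ => K * (1 - ((n : ℝ) + 1)⁻¹)) Filter.atTop
      (nhds (K * (1 - 0))) := by
    have := tendsto_one_div_add_atTop_nhds_zero_nat (𝕜 := ℝ)
    simp only [one_div] at this
    exact (tendsto_const_nhds.sub this).const_mul K
  have := le_of_tendsto' lim step
  linarith

end ScalarConvexity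

/-- The Hermitian dilation of a square matrix. -/
def hermitianDilation {n : Type*} (M : Matrix n n ℂ) : Matrix (n ⊕ n) (n ⊕ n) ℂ :=
  fromBlocks 0 M Mᴴ 0

lemma isHermitian_hermitianDilation {n : Type*} (M : Matrix n n ℂ) :
    (hermitianDilation M).IsHermitian := by
  simp [hermitianDilation, IsHermitian, fromBlocks_conjTranspose]

section SchattenSum

variable {n : Type*} [Fintype n] [DecidableEq n]

lemma schattenSum_eq_sum_eigenvalues (p : ℝ) (M : Matrix n n ℂ) :
    schattenSum p M = ∑ i, (posSemidef_conjTranspose_mul_self M).1.eigenvalues i ^ (p / 2) := by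
  rw [schattenSum, (posSemidef_conjTranspose_mul_self M).1.roots_charpoly_eq_eigenvalues,
    Multiset.map_map]
  rfl

lemma schattenSum_nonneg (p : ℝ) (M : Matrix n n ℂ) : 0 ≤ schattenSum p M := by
  rw [schattenSum_eq_sum_eigenvalues]
  exact Finset.sum_nonneg fun i _ =>
    Real.rpow_nonneg ((posSemidef_conjTranspose_mul_self M).eigenvalues_nonneg i) _

lemma schattenNorm_eq (p : ℝ) (M : Matrix n n ℂ) :
    schattenNorm p M = schattenSum p M ^ (1 / p) := by
  rw [schattenNorm, schattenSum_eq_sum_eigenvalues]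

lemma schattenSum_neg (p : ℝ) (M : Matrix n n ℂ) : schattenSum p (-M) = schattenSum p M := by
  simp [schattenSum]

lemma conjTranspose_conjDiag (U : Matrix n n ℂ) (x : n → ℝ) :
    (conjDiag U x)ᴴ = conjDiag U x := by
  simp [conjDiag, conjTranspose_mul, diagonal_conjTranspose, Pi.star_def, Matrix.mul_assoc]

lemma charpoly_conjDiag {U : Matrix n n ℂ} (hU : U ∈ unitaryGroup n ℂ) (x : n → ℝ) :
    (conjDiag U x).charpoly = ∏ i, (Polynomial.X - Polynomial.C (x i : ℂ)) := by
  have h : Uᴴ * U = 1 := mem_unitaryGroup_iff'.1 hU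
  rw [conjDiag, charpoly_mul_comm, ← Matrix.mul_assoc, h, Matrix.one_mul, charpoly_diagonal]

lemma schattenSum_conjDiag {U : Matrix n n ℂ} (hU : U ∈ unitaryGroup n ℂ) (x : n → ℝ) (p : ℝ) :
    schattenSum p (conjDiag U x) = ∑ i, |x i| ^ p := by
  rw [schattenSum, conjTranspose_conjDiag, conjDiag_mul_conjDiag hU, charpoly_conjDiag hU,
    Polynomial.roots_prod _ _ (Finset.prod_ne_zero_iff.2 fun i _ => Polynomial.X_sub_C_ne_zero _)]
  have h : ∀ t : ℝ, (t * t) ^ (p / 2) = |t| ^ p := by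
    intro t
    rw [← pow_two, ← sq_abs, ← Real.rpow_natCast, ← Real.rpow_mul (abs_nonneg t)]
    congr 1
    push_cast
    ring
  simp only [Polynomial.roots_X_sub_C, Multiset.bind_singleton, Multiset.map_map,
    Function.comp_apply, Complex.ofReal_re, h]
  rfl

lemma schattenSum_fromBlocks_diagonal {m : Type*} [Fintype m] [DecidableEq m]
    (p : ℝ) (M : Matrix n n ℂ) (N : Matrix m m ℂ) :
    schattenSum p (fromBlocks M 0 0 N) = schattenSum p M + schattenSum p N := by
  rw [schattenSum, fromBlocks_conjTranspose, fromBlocks_multiply]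
  simp only [conjTranspose_zero, Matrix.mul_zero, Matrix.zero_mul, add_zero, zero_add]
  rw [charpoly_fromBlocks_zero₁₂, Polynomial.roots_mul
    (mul_ne_zero (charpoly_monic _).ne_zero (charpoly_monic _).ne_zero), Multiset.map_add,
    Multiset.sum_add]
  rfl

lemma schattenSum_hermitianDilation (p : ℝ) (M : Matrix n n ℂ) :
    schattenSum p (hermitianDilation M) = 2 * schattenSum p M := by
  rw [schattenSum, hermitianDilation, fromBlocks_conjTranspose, fromBlocks_multiply]
  simp only [conjTranspose_zero, Matrix.mul_zero, Matrix.zero_mul, add_zero, zero_add,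
    conjTranspose_conjTranspose]
  rw [charpoly_fromBlocks_zero₁₂, Polynomial.roots_mul
    (mul_ne_zero (charpoly_monic _).ne_zero (charpoly_monic _).ne_zero), Multiset.map_add,
    Multiset.sum_add, charpoly_mul_comm, two_mul]
  rfl

end SchattenSum

section Convexity

variable {n : Type*} [Fintype n] [DecidableEq n] {U V : Matrix n n ℂ}

lemma re_trace_conjDiag_mul (U V : Matrix n n ℂ) (s t : n → ℝ) :
    (trace (conjDiag U s * conjDiag V t)).re =
      ∑ i, ∑ j, s i * t j * Complex.normSq ((Uᴴ * V) i j) := by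
  simpa using re_trace_conjDiag_mul_conjDiag 1 U V s t

lemma re_trace_conjDiag_left (hV : V ∈ unitaryGroup n ℂ) (s : n → ℝ) :
    (trace (conjDiag U s)).re = ∑ i, ∑ j, s i * Complex.normSq ((Uᴴ * V) i j) := by
  simpa [conjDiag_one_fun hV] using re_trace_conjDiag_mul U V s fun _ => 1

lemma re_trace_conjDiag_right (hU : U ∈ unitaryGroup n ℂ) (t : n → ℝ) :
    (trace (conjDiag V t)).re = ∑ i, ∑ j, t j * Complex.normSq ((Uᴴ * V) i j) := by
  simpa [conjDiag_one_fun hU] using re_trace_conjDiag_mul U V (fun _ => 1) t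

lemma re_trace_sub_mul_sub (hU : U ∈ unitaryGroup n ℂ) (hV : V ∈ unitaryGroup n ℂ)
    (x y : n → ℝ) (f : ℝ → ℝ) :
    (trace ((conjDiag U (fun i => f (x i)) - conjDiag V (fun i => f (y i))) *
      (conjDiag U x - conjDiag V y))).re =
      ∑ i, ∑ j, (x i - y j) * (f (x i) - f (y j)) * Complex.normSq ((Uᴴ * V) i j) := by
  rw [Matrix.sub_mul, Matrix.mul_sub, Matrix.mul_sub, conjDiag_mul_conjDiag hU,
    conjDiag_mul_conjDiag hV, trace_sub, trace_sub, trace_sub,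
    trace_mul_comm (conjDiag V fun i => f (y i)) (conjDiag U x), Complex.sub_re, Complex.sub_re,
    Complex.sub_re, re_trace_conjDiag_mul, re_trace_conjDiag_mul, re_trace_conjDiag_left hV,
    re_trace_conjDiag_right (V := V) hU]
  simp only [← Finset.sum_sub_distrib]
  refine Finset.sum_congr rfl fun i _ => Finset.sum_congr rfl fun j _ => ?_
  ring

lemma mul_re_trace_le_schattenSum_sub {p : ℝ} (hp : 1 < p) (hU : U ∈ unitaryGroup n ℂ)
    (hV : V ∈ unitaryGroup n ℂ) (x y : n → ℝ) :
    p * (trace (conjDiag U (fun i => oddRpow (p - 1) (x i)) * (conjDiag V y - conjDiag U x))).re ≤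
      schattenSum p (conjDiag V y) - schattenSum p (conjDiag U x) := by
  have hsum : ∀ {W : Matrix n n ℂ}, W ∈ unitaryGroup n ℂ → ∀ z : n → ℝ,
      schattenSum p (conjDiag W z) = (trace (conjDiag W fun i => |z i| ^ p)).re := by
    intro W hW z
    rw [schattenSum_conjDiag hW, trace, Complex.re_sum]
    simp only [diag_apply, conjDiag_apply_self_re]
    rw [Finset.sum_comm]
    refine Finset.sum_congr rfl fun i _ => ?_
    rw [← Finset.mul_sum, sum_normSq_col hW, mul_one]
  rw [hsum hU, hsum hV, Matrix.mul_sub, conjDiag_mul_conjDiag hU, trace_sub, Complex.sub_re,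
    re_trace_conjDiag_mul, re_trace_conjDiag_left (U := U) hV, re_trace_conjDiag_left (U := U) hV,
    re_trace_conjDiag_right (V := V) hU]
  simp only [← Finset.sum_sub_distrib]
  rw [Finset.mul_sum]
  refine Finset.sum_le_sum fun i _ => ?_
  rw [Finset.mul_sum]
  refine Finset.sum_le_sum fun j _ => ?_
  have := mul_le_mul_of_nonneg_right (mul_oddRpow_mul_sub_le hp (x i) (y j))
    (Complex.normSq_nonneg ((Uᴴ * V) i j))
  linarith

lemma mul_schattenSum_sub_rpow_le {p : ℝ} (hp1 : 1 < p) (hp2 : p < 2)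
    (hU : U ∈ unitaryGroup n ℂ) (hV : V ∈ unitaryGroup n ℂ) (x y : n → ℝ) :
    (p - 1) * schattenSum p (conjDiag U x - conjDiag V y) ^ (2 / p) ≤
      (trace ((conjDiag U (fun i => oddRpow (p - 1) (x i)) -
        conjDiag V (fun i => oddRpow (p - 1) (y i))) * (conjDiag U x - conjDiag V y))).re *
      ((schattenSum p (conjDiag U x) + schattenSum p (conjDiag V y)) / 2) ^ ((2 - p) / p) := by
  have hH : (conjDiag U x - conjDiag V y).IsHermitian :=
    IsHermitian.sub (conjTranspose_conjDiag U x) (conjTranspose_conjDiag V y)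
  obtain ⟨W, hW, hd⟩ := hH.exists_conjDiag
  set d := hH.eigenvalues
  have hW1 : Wᴴ * W = 1 := mem_unitaryGroup_iff'.1 hW
  have hW2 : W * Wᴴ = 1 := mem_unitaryGroup_iff.1 hW
  have hW' : Wᴴ ∈ unitaryGroup n ℂ := Unitary.star_mem hW
  have hconj : ∀ (T : Matrix n n ℂ) (z : n → ℝ),
      conjDiag (Wᴴ * T) z = Wᴴ * conjDiag T z * W := by
    intro T z
    simp [conjDiag, conjTranspose_mul, Matrix.mul_assoc]
  have hdiag : diagonal (fun k => (d k : ℂ)) = conjDiag (Wᴴ * U) x - conjDiag (Wᴴ * V) y := by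
    rw [hconj, hconj, ← Matrix.sub_mul, ← Matrix.mul_sub, ← hd, ← hconj, hW1]
    simp [conjDiag]
  have key := mul_rpow_sum_rpow_le_of_diagonal hp1 hp2 (mul_mem hW' hU) (mul_mem hW' hV) hdiag
  have hov : (Wᴴ * U)ᴴ * (Wᴴ * V) = Uᴴ * V := by
    rw [conjTranspose_mul, conjTranspose_conjTranspose, Matrix.mul_assoc, ← Matrix.mul_assoc W,
      hW2, Matrix.one_mul]
  rw [hov] at key
  rw [re_trace_sub_mul_sub hU hV x y (oddRpow (p - 1)), schattenSum_conjDiag hU,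
    schattenSum_conjDiag hV, ← hd, schattenSum_conjDiag hW]
  exact key

lemma schattenSum_smul (p : ℝ) {c : ℝ} (hc : 0 ≤ c) {X : Matrix n n ℂ}
    (hX : X.IsHermitian) :
    schattenSum p ((c : ℂ) • X) = c ^ p * schattenSum p X := by
  obtain ⟨U, hU, hd⟩ := hX.exists_conjDiag
  set d := hX.eigenvalues
  have e : (c : ℂ) • X = conjDiag U (fun i => c * d i) := by
    have : diagonal (fun i => ((c * d i : ℝ) : ℂ)) = (c : ℂ) • diagonal (fun i => (d i : ℂ)) := by
      rw [← diagonal_smul]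
      congr 1
      ext i
      simp
    rw [← hd, conjDiag, conjDiag, this, Matrix.mul_smul, Matrix.smul_mul]
  rw [e, ← hd, schattenSum_conjDiag hU, schattenSum_conjDiag hU, Finset.mul_sum]
  refine Finset.sum_congr rfl fun i _ => ?_
  rw [abs_mul, abs_of_nonneg hc, Real.mul_rpow hc (abs_nonneg _)]

lemma schattenSum_rpow_add_le_of_even {p : ℝ} (hp1 : 1 < p) (hp2 : p < 2) {X Y : Matrix n n ℂ}
    (hX : X.IsHermitian) (hY : Y.IsHermitian)
    (heven : ∀ r : ℝ, schattenSum p (X + (r : ℂ) • Y) = schattenSum p (X - (r : ℂ) • Y)) :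
    schattenSum p X ^ (2 / p) + (p - 1) * schattenSum p Y ^ (2 / p) ≤
      schattenSum p (X + Y) ^ (2 / p) := by
  have hp0 : 0 < p := by linarith
  have h2p : 1 < 2 / p := by
    rw [lt_div_iff₀ hp0]
    linarith
  have hrY : ∀ r : ℝ, ((r : ℂ) • Y).IsHermitian := fun r => by
    rw [IsHermitian, conjTranspose_smul, hY.eq]
    simp
  have main := add_le_of_forall_mul_le_sub
    (g := fun r : ℝ => schattenSum p (X + (r : ℂ) • Y) ^ (2 / p))
    (K := (p - 1) * schattenSum p Y ^ (2 / p)) (by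
    intro r s hr hrs
    obtain ⟨U, hU, hx⟩ := (hX.add (hrY r)).exists_conjDiag
    obtain ⟨V, hV, hy⟩ := (hX.sub (hrY r)).exists_conjDiag
    obtain ⟨U', hU', hx'⟩ := (hX.add (hrY s)).exists_conjDiag
    obtain ⟨V', hV', hy'⟩ := (hX.sub (hrY s)).exists_conjDiag
    set x := (hX.add (hrY r)).eigenvalues
    set y := (hX.sub (hrY r)).eigenvalues
    set x' := (hX.add (hrY s)).eigenvalues
    set y' := (hX.sub (hrY s)).eigenvalues
    set P := conjDiag U (fun i => oddRpow (p - 1) (x i))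
    set Q := conjDiag V (fun i => oddRpow (p - 1) (y i))
    have c1 := mul_re_trace_le_schattenSum_sub hp1 hU hU' x x'
    have c2 := mul_re_trace_le_schattenSum_sub hp1 hV hV' y y'
    have c2' := mul_re_trace_le_schattenSum_sub hp1 hU hV' x y'
    have c3 := mul_schattenSum_sub_rpow_le hp1 hp2 hU hV x y
    rw [hx, hx'] at c1
    rw [hy, hy', ← heven, ← heven] at c2
    rw [hx, hy', ← heven] at c2'
    rw [hx, hy, ← heven, add_self_div_two] at c3
    set a := schattenSum p (X + (r : ℂ) • Y) with ha
    set b := schattenSum p (X + (s : ℂ) • Y) with hb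
    set τ := (trace ((P - Q) * Y)).re with hτ
    have ha0 : 0 ≤ a := schattenSum_nonneg _ _
    have hb0 : 0 ≤ b := schattenSum_nonneg _ _
    have e1 : X + (s : ℂ) • Y - (X + (r : ℂ) • Y) = ((s - r : ℝ) : ℂ) • Y := by
      push_cast
      module
    have e2 : X - (s : ℂ) • Y - (X - (r : ℂ) • Y) = ((-(s - r) : ℝ) : ℂ) • Y := by
      push_cast
      module
    have e2' : X - (s : ℂ) • Y - (X + (r : ℂ) • Y) = ((-(s + r) : ℝ) : ℂ) • Y := by
      push_cast
      module
    have e3 : X + (r : ℂ) • Y - (X - (r : ℂ) • Y) = ((2 * r : ℝ) : ℂ) • Y := by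
      push_cast
      module
    rw [e1, Matrix.mul_smul, trace_smul, smul_eq_mul, Complex.re_ofReal_mul] at c1
    rw [e2, Matrix.mul_smul, trace_smul, smul_eq_mul, Complex.re_ofReal_mul] at c2
    rw [e2', Matrix.mul_smul, trace_smul, smul_eq_mul, Complex.re_ofReal_mul] at c2'
    rw [e3, Matrix.mul_smul, trace_smul, smul_eq_mul, Complex.re_ofReal_mul,
      schattenSum_smul p (by positivity) hY, Real.mul_rpow (by positivity)
      (schattenSum_nonneg _ _), ← Real.rpow_mul (by positivity), mul_div_cancel₀ _ hp0.ne'] at c3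
    have hτ' : τ = (trace (P * Y)).re - (trace (Q * Y)).re := by
      rw [hτ, Matrix.sub_mul, trace_sub, Complex.sub_re]
    have c12 : p * (s - r) * τ ≤ 2 * (b - a) := by
      rw [hτ']
      linarith
    set S := schattenSum p Y ^ (2 / p)
    have hex : (2 - p) / p = 2 / p - 1 := by
      field_simp
    rw [hex, Real.rpow_two] at c3
    have c4 := mul_rpow_sub_one_mul_le h2p ha0 hb0
    set A := a ^ (2 / p - 1)
    have hA : 0 ≤ A := Real.rpow_nonneg ha0 _
    have c5 : p * (2 * (p - 1) * r * S * (s - r)) ≤ 2 * (b - a) * A := by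
      rcases hr.eq_or_lt with rfl | hr
      · have hba : 0 ≤ b - a := by linarith
        have : 0 ≤ 2 * (b - a) * A := by positivity
        simpa using this
      · have h1 : r * (2 * (2 * (p - 1) * r * S)) ≤ r * (2 * (τ * A)) := by linarith
        have h2 := mul_le_mul_of_nonneg_right (le_of_mul_le_mul_left h1 hr) (sub_nonneg.2 hrs)
        have h3 := mul_le_mul_of_nonneg_left h2 hp0.le
        have h4 := mul_le_mul_of_nonneg_right c12 hA
        linarith
    refine le_trans ?_ c4
    have e : 2 / p * A * (b - a) = (2 * (b - a)) * A / p := by ring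
    rw [e, le_div_iff₀ hp0]
    linarith)
  simpa using main

end Convexity

lemma ball_carlen_lieb_of_lt {m : Type*} [Fintype m] [DecidableEq m]
    (A B : Matrix m m ℂ) {p : ℝ} (hp1 : 1 < p) (hp2 : p < 2) :
    schattenNorm p A ^ (2 : ℝ) + (p - 1) * schattenNorm p B ^ (2 : ℝ) ≤
      ((schattenNorm p (A + B) ^ p + schattenNorm p (A - B) ^ p) / 2) ^ (2 / p) := by
  have hp0 : 0 < p := by linarith
  set X := fromBlocks (hermitianDilation A) 0 0 (hermitianDilation A) with hX
  set Y := fromBlocks (hermitianDilation B) 0 0 (-hermitianDilation B) with hY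
  have hXH : X.IsHermitian := IsHermitian.fromBlocks (isHermitian_hermitianDilation A) (by simp)
    (isHermitian_hermitianDilation A)
  have hYH : Y.IsHermitian := IsHermitian.fromBlocks (isHermitian_hermitianDilation B) (by simp)
    (isHermitian_hermitianDilation B).neg
  have hadd : ∀ r : ℝ, X + (r : ℂ) • Y = fromBlocks (hermitianDilation (A + (r : ℂ) • B)) 0 0
      (hermitianDilation (A - (r : ℂ) • B)) := by
    intro r
    simp [hX, hY, hermitianDilation, fromBlocks_add, fromBlocks_smul, fromBlocks_neg,
      sub_eq_add_neg]
  have hsum : ∀ r : ℝ, schattenSum p (X + (r : ℂ) • Y) =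
      2 * schattenSum p (A + (r : ℂ) • B) + 2 * schattenSum p (A - (r : ℂ) • B) := by
    intro r
    rw [hadd, schattenSum_fromBlocks_diagonal, schattenSum_hermitianDilation,
      schattenSum_hermitianDilation]
  have key := schattenSum_rpow_add_le_of_even hp1 hp2 hXH hYH (by
    intro r
    have h := hsum (-r)
    simp only [Complex.ofReal_neg, neg_smul, ← sub_eq_add_neg, sub_neg_eq_add] at h
    rw [hsum, h, add_comm])
  have h1 : schattenSum p (X + Y) =
      4 * ((schattenSum p (A + B) + schattenSum p (A - B)) / 2) := by
    have h := hsum 1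
    simp only [Complex.ofReal_one, one_smul] at h
    rw [h]
    ring
  have h2 : schattenSum p X = 4 * schattenSum p A := by
    rw [hX, schattenSum_fromBlocks_diagonal, schattenSum_hermitianDilation]
    ring
  have h3 : schattenSum p Y = 4 * schattenSum p B := by
    rw [hY, schattenSum_fromBlocks_diagonal, schattenSum_neg, schattenSum_hermitianDilation]
    ring
  have n1 : ∀ M : Matrix m m ℂ, schattenNorm p M ^ (2 : ℝ) = schattenSum p M ^ (2 / p) := by
    intro M
    rw [schattenNorm_eq, ← Real.rpow_mul (schattenSum_nonneg p M)]
    congr 1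
    ring
  have n2 : ∀ M : Matrix m m ℂ, schattenNorm p M ^ p = schattenSum p M := by
    intro M
    rw [schattenNorm_eq, ← Real.rpow_mul (schattenSum_nonneg p M), one_div_mul_cancel hp0.ne',
      Real.rpow_one]
  have nn := fun M : Matrix m m ℂ => schattenSum_nonneg p M
  have n3 : 0 ≤ (schattenSum p (A + B) + schattenSum p (A - B)) / 2 := by
    have := nn (A + B)
    have := nn (A - B)
    positivity
  rw [h1, h2, h3, Real.mul_rpow (by norm_num) (nn A), Real.mul_rpow (by norm_num) (nn B),
    Real.mul_rpow (by norm_num) n3] at key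
  rw [n1, n1, n2, n2]
  have h4 : (0 : ℝ) < 4 ^ (2 / p) := by positivity
  refine le_of_mul_le_mul_left ?_ h4
  linarith

lemma continuousAt_schattenNorm {m : Type*} [Fintype m] [DecidableEq m] (X : Matrix m m ℂ)
    {p : ℝ} (hp : 0 < p) : ContinuousAt (fun q => schattenNorm q X) p := by
  unfold schattenNorm
  refine ContinuousAt.rpow ?_ (by fun_prop (disch := exact hp.ne')) (Or.inr (by positivity))
  refine tendsto_finsetSum _ fun i _ => ?_
  exact ContinuousAt.rpow continuousAt_const (by fun_prop) (Or.inr (by positivity))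

theorem ball_carlen_lieb {m : Type*} [Fintype m] [DecidableEq m]
    (A B : Matrix m m ℂ) (p : ℝ) (hp1 : 1 ≤ p) (hp2 : p ≤ 2) :
    schattenNorm p A ^ (2 : ℝ) + (p - 1) * schattenNorm p B ^ (2 : ℝ) ≤
      ((schattenNorm p (A + B) ^ p + schattenNorm p (A - B) ^ p) / 2) ^ (2 / p) := by
  have hp0 : 0 < p := by linarith
  have hmem : p ∈ closure (Set.Ioo (1 : ℝ) 2) := by
    rw [closure_Ioo (by norm_num)]
    exact ⟨hp1, hp2⟩
  have hc := fun X : Matrix m m ℂ => continuousAt_schattenNorm X hp0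
  have hl : ContinuousAt (fun q => schattenNorm q A ^ (2 : ℝ) +
      (q - 1) * schattenNorm q B ^ (2 : ℝ)) p :=
    ((hc A).rpow_const (Or.inr (by norm_num))).add
      ((continuousAt_id.sub continuousAt_const).mul ((hc B).rpow_const (Or.inr (by norm_num))))
  have hr : ContinuousAt (fun q => ((schattenNorm q (A + B) ^ q +
      schattenNorm q (A - B) ^ q) / 2) ^ (2 / q)) p := by
    refine ContinuousAt.rpow ?_ (by fun_prop (disch := exact hp0.ne')) (Or.inr (by positivity))
    exact (((hc (A + B)).rpow continuousAt_id (Or.inr hp0)).add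
      ((hc (A - B)).rpow continuousAt_id (Or.inr hp0))).div_const 2
  exact hl.continuousWithinAt.closure_le hmem hr.continuousWithinAt fun q hq =>
    ball_carlen_lieb_of_lt A B hq.1 hq.2
end

section
/- For complex square matrices A, B and 2 ≤ p: ((‖A+B‖_p^p + ‖A−B‖_p^p)/2)^(2/p) ≤ ‖A‖_p^2 + (p−1)·‖B‖_p^2. -/
open scoped ComplexOrder

theorem rpow_add_one_sub_le_trapezoid {q a b : ℝ} (hq : 1 ≤ q) (hb : 0 ≤ b) (hab : b ≤ a) :
    a ^ (q + 1) - b ^ (q + 1) ≤ (q + 1) * ((a ^ q + b ^ q) / 2) * (a - b) := by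
  have hderiv (x : ℝ) : HasDerivAt
      (fun x : ℝ => (q + 1) * ((x ^ q + b ^ q) / 2) * (x - b) - (x ^ (q + 1) - b ^ (q + 1)))
      ((q + 1) / 2 * (b ^ q - x ^ q - q * x ^ (q - 1) * (b - x))) x := by
    have h1 : HasDerivAt (fun x : ℝ => x ^ q) (q * x ^ (q - 1)) x :=
      Real.hasDerivAt_rpow_const (Or.inr hq)
    have h2 : HasDerivAt (fun x : ℝ => x ^ (q + 1)) ((q + 1) * x ^ (q + 1 - 1)) x :=
      Real.hasDerivAt_rpow_const (Or.inr (by linarith))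
    refine (((((h1.add_const (b ^ q)).div_const 2).const_mul (q + 1)).mul
      ((hasDerivAt_id x).sub_const b)).sub (h2.sub_const (b ^ (q + 1)))).congr_deriv ?_
    simp only [id, add_sub_cancel_right]
    ring
  have hmono := monotoneOn_of_deriv_nonneg (convex_Ici b)
    (fun x _ => (hderiv x).continuousAt.continuousWithinAt)
    (fun x _ => (hderiv x).differentiableAt.differentiableWithinAt) (fun x hx => by
      rw [interior_Ici, Set.mem_Ioi] at hx
      rw [(hderiv x).deriv]
      have hx0 : 0 < x := hb.trans_lt hx
      have ht : q * x ^ (q - 1) * (b - x) ≤ b ^ q - x ^ q := by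
        have := one_add_mul_self_le_rpow_one_add (s := b / x - 1) (by
          have := div_nonneg hb hx0.le; linarith) hq
        rw [show 1 + (b / x - 1) = b / x by ring, Real.div_rpow hb hx0.le,
          le_div_iff₀ (by positivity)] at this
        have hxq : x ^ q = x ^ (q - 1) * x := by
          rw [← Real.rpow_add_one hx0.ne']; simp
        have h3 : (1 + q * (b / x - 1)) * x ^ q = x ^ q + q * x ^ (q - 1) * (b - x) := by
          rw [hxq]; field_simp
        linarith
      have : 0 ≤ (q + 1) / 2 := by linarith
      exact mul_nonneg this (by linarith))
  have := hmono (Set.mem_Ici.2 le_rfl) (Set.mem_Ici.2 hab) hab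
  simp only [sub_self, mul_zero] at this
  linarith

theorem rpow_add_one_sub_le_midpoint {q a b : ℝ} (hq0 : 0 ≤ q) (hq1 : q ≤ 1) (hb : 0 ≤ b)
    (hab : b ≤ a) :
    a ^ (q + 1) - b ^ (q + 1) ≤ (q + 1) * ((a + b) / 2) ^ q * (a - b) := by
  set c := (a + b) / 2 with hc
  have hderiv (x : ℝ) : HasDerivAt
      (fun x : ℝ => (q + 1) * c ^ q * (2 * x) - ((c + x) ^ (q + 1) - (c - x) ^ (q + 1)))
      ((q + 1) * (2 * c ^ q - (c + x) ^ q - (c - x) ^ q)) x := by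
    have h2 := ((hasDerivAt_id x).const_add c).rpow_const (p := q + 1) (Or.inr (by linarith))
    have h3 := ((hasDerivAt_id x).const_sub c).rpow_const (p := q + 1) (Or.inr (by linarith))
    refine ((((hasDerivAt_id x).const_mul 2).const_mul ((q + 1) * c ^ q)).sub
      (h2.sub h3)).congr_deriv ?_
    simp only [id, add_sub_cancel_right]
    ring
  have hmono := monotoneOn_of_deriv_nonneg (convex_Icc 0 c)
    (fun x _ => (hderiv x).continuousAt.continuousWithinAt)
    (fun x _ => (hderiv x).differentiableAt.differentiableWithinAt) (fun x hx => by
      rw [interior_Icc, Set.mem_Ioo] at hx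
      rw [(hderiv x).deriv]
      have ht := (Real.concaveOn_rpow hq0 hq1).2 (x := c + x) (y := c - x)
        (Set.mem_Ici.2 (by linarith)) (Set.mem_Ici.2 (by linarith))
        (by norm_num : (0 : ℝ) ≤ 1 / 2) (by norm_num : (0 : ℝ) ≤ 1 / 2) (by norm_num)
      simp only [smul_eq_mul] at ht
      rw [show 1 / 2 * (c + x) + 1 / 2 * (c - x) = c by ring] at ht
      have : 0 ≤ q + 1 := by linarith
      exact mul_nonneg this (by linarith))
  have := hmono (Set.mem_Icc.2 ⟨le_rfl, by linarith⟩) (b := (a - b) / 2)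
    (Set.mem_Icc.2 ⟨by linarith, by linarith⟩) (by linarith)
  simp only [add_zero, mul_zero, sub_zero, sub_self] at this
  rw [show c + (a - b) / 2 = a by rw [hc]; ring, show c - (a - b) / 2 = b by rw [hc]; ring] at this
  linarith

theorem add_rpow_le_of_sub_rpow_le {q a b K : ℝ} (hq : 0 ≤ q) (hb : 0 ≤ b) (hab : b < a)
    (h : a ^ (q + 1) - b ^ (q + 1) ≤ K * (a - b)) :
    a ^ (q + 1) + b ^ (q + 1) ≤ K * (a + b) := by
  have ha : 0 < a := hb.trans_lt hab
  have h1 : a ^ (q + 1) = a ^ q * a := Real.rpow_add_one ha.ne' q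
  have h2 : b ^ (q + 1) = b ^ q * b := by
    rcases hb.eq_or_lt with rfl | hb'
    · rw [Real.zero_rpow (by linarith), mul_zero]
    · exact Real.rpow_add_one hb'.ne' q
  have h3 : b ^ q ≤ a ^ q := Real.rpow_le_rpow hb hab.le hq
  have h4 : (a ^ (q + 1) + b ^ (q + 1)) * (a - b) ≤ (a ^ (q + 1) - b ^ (q + 1)) * (a + b) := by
    have : (a ^ (q + 1) - b ^ (q + 1)) * (a + b) - (a ^ (q + 1) + b ^ (q + 1)) * (a - b)
      = 2 * (a * b) * (a ^ q - b ^ q) := by rw [h1, h2]; ring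
    have h5 : 0 ≤ 2 * (a * b) * (a ^ q - b ^ q) := by
      have : 0 ≤ a ^ q - b ^ q := by linarith
      positivity
    linarith
  have h5 : (a ^ (q + 1) - b ^ (q + 1)) * (a + b) ≤ K * (a - b) * (a + b) :=
    mul_le_mul_of_nonneg_right h (by linarith)
  refine le_of_mul_le_mul_right ?_ (sub_pos.2 hab)
  linarith

theorem sub_mul_sub_abs_rpow_mul_le {q x y K : ℝ} (hq : 0 ≤ q)
    (hdiag : |x| ^ q ≤ K ∨ |y| ≠ |x|)
    (h₁ : |y| ≤ |x| → |x| ^ (q + 1) - |y| ^ (q + 1) ≤ (q + 1) * K * (|x| - |y|))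
    (h₂ : |x| ≤ |y| → |y| ^ (q + 1) - |x| ^ (q + 1) ≤ (q + 1) * K * (|y| - |x|)) :
    (x - y) * (|x| ^ q * x - |y| ^ q * y) ≤ (q + 1) * (x - y) ^ 2 * K := by
  have key (a : ℝ) (ha : 0 ≤ a) : a ^ (q + 1) = a ^ q * a := by
    rcases ha.eq_or_lt with rfl | ha'
    · rw [Real.zero_rpow (by linarith), mul_zero]
    · exact Real.rpow_add_one ha'.ne' q
  have hadd : |x| ^ (q + 1) + |y| ^ (q + 1) ≤ (q + 1) * K * (|x| + |y|) := by
    rcases lt_trichotomy |y| |x| with h | h | h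
    · exact add_rpow_le_of_sub_rpow_le hq (abs_nonneg _) h (h₁ h.le)
    · have hK : |x| ^ q ≤ K := hdiag.resolve_right (fun h' => h' h)
      rw [h, key _ (abs_nonneg _)]
      have hK0 : 0 ≤ K := (Real.rpow_nonneg (abs_nonneg _) _).trans hK
      have h6 : |x| ^ q * |x| ≤ K * |x| := mul_le_mul_of_nonneg_right hK (abs_nonneg _)
      have h7 : 0 ≤ q * (K * |x|) := by positivity
      linarith
    · have := add_rpow_le_of_sub_rpow_le hq (abs_nonneg _) h (h₂ h.le)
      linarith
  have hsub : (|x| - |y|) * (|x| ^ (q + 1) - |y| ^ (q + 1)) ≤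
      (q + 1) * K * (|x| - |y|) ^ 2 := by
    rcases le_total |y| |x| with h | h
    · nlinarith [mul_le_mul_of_nonneg_left (h₁ h) (sub_nonneg.2 h)]
    · nlinarith [mul_le_mul_of_nonneg_left (h₂ h) (sub_nonneg.2 h)]
  have hadd' : (|x| + |y|) * (|x| ^ (q + 1) + |y| ^ (q + 1)) ≤
      (q + 1) * K * (|x| + |y|) ^ 2 := by
    nlinarith [mul_le_mul_of_nonneg_left hadd (add_nonneg (abs_nonneg x) (abs_nonneg y))]
  rw [key _ (abs_nonneg _), key _ (abs_nonneg _)] at hsub hadd'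
  rcases abs_cases x with ⟨hx, _⟩ | ⟨hx, _⟩ <;> rcases abs_cases y with ⟨hy, _⟩ | ⟨hy, _⟩ <;>
    simp only [hx, hy] at hsub hadd' ⊢ <;> linarith

theorem sub_mul_sub_le_trapezoid {q : ℝ} (hq : 1 ≤ q) (x y : ℝ) :
    (x - y) * (|x| ^ q * x - |y| ^ q * y) ≤
      (q + 1) * (x - y) ^ 2 * ((|x| ^ q + |y| ^ q) / 2) := by
  apply sub_mul_sub_abs_rpow_mul_le (by linarith)
  · by_cases h : |y| = |x|
    · left; rw [h]; linarith
    · exact Or.inr h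
  · exact rpow_add_one_sub_le_trapezoid hq (abs_nonneg _)
  · rw [add_comm (|x| ^ q)]
    exact rpow_add_one_sub_le_trapezoid hq (abs_nonneg _)

theorem sub_mul_sub_le_midpoint {q : ℝ} (hq0 : 0 ≤ q) (hq1 : q ≤ 1) (x y : ℝ) :
    (x - y) * (|x| ^ q * x - |y| ^ q * y) ≤
      (q + 1) * (x - y) ^ 2 * ((|x| + |y|) / 2) ^ q := by
  apply sub_mul_sub_abs_rpow_mul_le hq0
  · by_cases h : |y| = |x|
    · left; rw [h, add_self_div_two]
    · exact Or.inr h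
  · exact rpow_add_one_sub_le_midpoint hq0 hq1 (abs_nonneg _)
  · rw [add_comm |x|]
    exact rpow_add_one_sub_le_midpoint hq0 hq1 (abs_nonneg _)

theorem abs_rpow_sub_abs_rpow_le {p : ℝ} (hp : 2 ≤ p) (x y : ℝ) :
    |x| ^ p - |y| ^ p ≤ p * (|x| ^ (p - 2) * x * (x - y)) := by
  have hconj : (p / (p - 1)).HolderConjugate p := by
    rw [Real.holderConjugate_iff]
    constructor
    · rw [lt_div_iff₀] <;> linarith
    · field_simp; ring
  have hy := Real.young_inequality_of_nonneg (Real.rpow_nonneg (abs_nonneg x) (p - 1))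
    (abs_nonneg y) hconj
  rw [← Real.rpow_mul (abs_nonneg _), mul_div_cancel₀ _ (by linarith : p - 1 ≠ 0)] at hy
  have h1 : |x| ^ (p - 1) = |x| ^ (p - 2) * |x| := by
    rcases (abs_nonneg x).eq_or_lt with h | h
    · rw [← h, Real.zero_rpow (by linarith), mul_zero]
    · rw [← Real.rpow_add_one h.ne']; congr 1; ring
  have h2 : |x| ^ p = |x| ^ (p - 2) * x ^ 2 := by
    rcases (abs_nonneg x).eq_or_lt with h | h
    · rw [← h, Real.zero_rpow (by linarith), abs_eq_zero.1 h.symm]; simp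
    · rw [← sq_abs, ← Real.rpow_natCast, ← Real.rpow_add h]; congr 1; norm_num
  have h3 : p * (|x| ^ (p - 1) * |y|) ≤ (p - 1) * |x| ^ p + |y| ^ p := by
    calc _ ≤ p * (|x| ^ p / (p / (p - 1)) + |y| ^ p / p) :=
        mul_le_mul_of_nonneg_left hy (by linarith)
      _ = _ := by field_simp
  have h4 : p * (|x| ^ (p - 2) * (x * y)) ≤ p * (|x| ^ (p - 1) * |y|) := by
    rw [h1, mul_assoc, ← abs_mul]
    have := Real.rpow_nonneg (abs_nonneg x) (p - 2)
    have := le_abs_self (x * y)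
    gcongr
  have h5 : p * (|x| ^ (p - 2) * x * (x - y)) =
      p * (|x| ^ (p - 2) * x ^ 2) - p * (|x| ^ (p - 2) * (x * y)) := by ring
  rw [h5, ← h2]
  linarith

open Matrix in
theorem sum_re_conj_mul_diagonal_conj {n : Type*} [Fintype n] [DecidableEq n]
    {P R : Matrix n n ℂ} (hR : R * Rᴴ = 1) (u v : n → ℝ) (i : n) :
    ∑ j, (star ((P * diagonal (fun k => (u k : ℂ)) * R) i j) *
      (P * diagonal (fun k => (v k : ℂ)) * R) i j).re = ∑ k, u k * v k * ‖P i k‖ ^ 2 := by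
  have h : (P * diagonal (fun k => (v k : ℂ)) * R) * (P * diagonal (fun k => (u k : ℂ)) * R)ᴴ =
      P * diagonal (fun k => ((u k * v k : ℝ) : ℂ)) * Pᴴ := by
    have hu : (fun k => star (u k : ℂ)) = fun k => (u k : ℂ) := by
      ext k; exact Complex.conj_ofReal _
    rw [conjTranspose_mul, conjTranspose_mul, diagonal_conjTranspose]
    change _ * (Rᴴ * (diagonal (fun k => star (u k : ℂ)) * Pᴴ)) = _
    rw [hu]
    calc _ = P * diagonal (fun k => (v k : ℂ)) * (R * Rᴴ) * diagonal (fun k => (u k : ℂ)) * Pᴴ := by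
          simp only [Matrix.mul_assoc]
      _ = _ := by
          rw [hR, Matrix.mul_one, Matrix.mul_assoc P, diagonal_mul_diagonal]
          congr 3
          ext k
          push_cast
          ring
  have h2 := congrArg Complex.re (congrFun (congrFun h i) i)
  rw [mul_apply, mul_apply, Complex.re_sum, Complex.re_sum] at h2
  calc _ = ∑ j, ((P * diagonal (fun k => (v k : ℂ)) * R) i j *
      (P * diagonal (fun k => (u k : ℂ)) * R)ᴴ j i).re :=
        Finset.sum_congr rfl fun j _ => by rw [conjTranspose_apply, mul_comm]
    _ = _ := h2
    _ = _ := Finset.sum_congr rfl fun k _ => by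
      rw [mul_diagonal, conjTranspose_apply, mul_right_comm, ← Complex.normSq_eq_norm_sq]
      rw [Complex.star_def, Complex.mul_conj, ← Complex.ofReal_mul, Complex.ofReal_re]
      ring

open Matrix in
theorem sum_norm_sq_mul_diagonal_row {n : Type*} [Fintype n] [DecidableEq n]
    {P R : Matrix n n ℂ} (hR : R * Rᴴ = 1) (d a : n → ℝ) :
    ∑ i, ∑ j, ‖(P * diagonal (fun k => (d k : ℂ)) * R) i j‖ ^ 2 * a i =
      ∑ k, d k ^ 2 * ∑ i, ‖P i k‖ ^ 2 * a i := by
  have h (i : n) := sum_re_conj_mul_diagonal_conj (P := P) hR d d i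
  have h' (z : ℂ) : (star z * z).re = ‖z‖ ^ 2 := by
    rw [← Complex.normSq_eq_norm_sq, Complex.star_def, ← Complex.normSq_eq_conj_mul_self]; simp
  simp only [h'] at h
  simp only [← Finset.sum_mul, h]
  simp only [Finset.sum_mul, Finset.mul_sum]
  rw [Finset.sum_comm]
  exact Finset.sum_congr rfl fun _ _ => Finset.sum_congr rfl fun _ _ => by ring

open Matrix in
theorem sum_norm_sq_mul_diagonal_col {n : Type*} [Fintype n] [DecidableEq n]
    {P R : Matrix n n ℂ} (hP : Pᴴ * P = 1) (d b : n → ℝ) :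
    ∑ i, ∑ j, ‖(P * diagonal (fun k => (d k : ℂ)) * R) i j‖ ^ 2 * b j =
      ∑ k, d k ^ 2 * ∑ j, ‖R k j‖ ^ 2 * b j := by
  have hP' : Pᵀ * (Pᵀ)ᴴ = 1 := by
    rw [← transpose_one, ← hP, transpose_mul]
    rfl
  have h := sum_norm_sq_mul_diagonal_row (P := Rᵀ) hP' d b
  simp only [transpose_apply] at h
  rw [Finset.sum_comm, ← h]
  refine Finset.sum_congr rfl fun i _ => Finset.sum_congr rfl fun j _ => ?_
  congr 3
  rw [← transpose_apply (P * diagonal (fun k => (d k : ℂ)) * R), transpose_mul, transpose_mul,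
    diagonal_transpose, Matrix.mul_assoc]

open Matrix in
theorem sum_norm_sq_row_eq_one {n : Type*} [Fintype n] [DecidableEq n]
    {P : Matrix n n ℂ} (hP : P * Pᴴ = 1) (i : n) : ∑ k, ‖P i k‖ ^ 2 = 1 := by
  have := congrArg Complex.re (congrFun (congrFun hP i) i)
  rw [mul_apply, Complex.re_sum, one_apply_eq] at this
  rw [← Complex.one_re, ← this]
  refine Finset.sum_congr rfl fun k _ => ?_
  rw [conjTranspose_apply, ← Complex.normSq_eq_norm_sq, Complex.star_def, Complex.mul_conj]; simp

open Matrix in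
theorem sum_norm_sq_col_eq_one {n : Type*} [Fintype n] [DecidableEq n]
    {P : Matrix n n ℂ} (hP : Pᴴ * P = 1) (k : n) : ∑ i, ‖P i k‖ ^ 2 = 1 := by
  have := sum_norm_sq_row_eq_one (P := Pᴴ) (by rwa [conjTranspose_conjTranspose]) k
  simpa using this

open Matrix in
/-- A compression inequality for the resolvents of a sum of left and right multiplications. -/
theorem sum_norm_sq_mul_div_add_le {n : Type*} [Fintype n] [DecidableEq n]
    {P R : Matrix n n ℂ} (hP : Pᴴ * P = 1) (hR : R * Rᴴ = 1) (d a b : n → ℝ)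
    (hab : ∀ i j, 0 ≤ a i + b j) {x : n → ℝ} (hx0 : ∀ k, 0 ≤ x k)
    (hx : ∀ k, x k = ∑ i, ‖P i k‖ ^ 2 * a i + ∑ j, ‖R k j‖ ^ 2 * b j) {t : ℝ} (ht : 0 < t) :
    ∑ i, ∑ j, ‖(P * diagonal (fun k => (d k : ℂ)) * R) i j‖ ^ 2 * (t⁻¹ - (t + (a i + b j))⁻¹) ≤
      ∑ k, d k ^ 2 * (t⁻¹ - (t + x k)⁻¹) := by
  set E := P * diagonal (fun k => (d k : ℂ)) * R with hE
  set u : n → ℝ := fun k => d k / (t + x k) with hu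
  set F := P * diagonal (fun k => (u k : ℂ)) * R with hF
  have hpt (i j : n) : ‖E i j‖ ^ 2 * (t⁻¹ - (t + (a i + b j))⁻¹) ≤
      ‖E i j‖ ^ 2 * t⁻¹ - 2 * (star (E i j) * F i j).re + ‖F i j‖ ^ 2 * t +
        ‖F i j‖ ^ 2 * a i + ‖F i j‖ ^ 2 * b j := by
    have hs : 0 < t + (a i + b j) := by linarith [hab i j]
    set s := t + (a i + b j) with hsdef
    have h1 : (star (E i j) * F i j).re ≤ ‖E i j‖ * ‖F i j‖ := by
      refine (Complex.re_le_norm _).trans ?_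
      rw [norm_mul, norm_star]
    have h2 : 2 * (‖E i j‖ * ‖F i j‖) ≤ ‖E i j‖ ^ 2 * s⁻¹ + ‖F i j‖ ^ 2 * s := by
      have h3 : 0 ≤ s⁻¹ * (‖E i j‖ - ‖F i j‖ * s) ^ 2 := by positivity
      have h4 : s⁻¹ * (‖E i j‖ - ‖F i j‖ * s) ^ 2 =
        ‖E i j‖ ^ 2 * s⁻¹ + ‖F i j‖ ^ 2 * s - 2 * (‖E i j‖ * ‖F i j‖) := by field_simp; ring
      linarith
    have h5 : ‖F i j‖ ^ 2 * s = ‖F i j‖ ^ 2 * t + ‖F i j‖ ^ 2 * a i + ‖F i j‖ ^ 2 * b j := by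
      rw [hsdef]; ring
    linarith
  have hone (v : n → ℝ) (c : ℝ) :
      ∑ i, ∑ j, ‖(P * diagonal (fun k => (v k : ℂ)) * R) i j‖ ^ 2 * c = ∑ k, v k ^ 2 * c := by
    rw [sum_norm_sq_mul_diagonal_row hR v (fun _ => c)]
    simp only [← Finset.sum_mul, sum_norm_sq_col_eq_one hP, one_mul]
  have hcross : ∑ i, ∑ j, 2 * (star (E i j) * F i j).re = ∑ k, 2 * (d k * u k) := by
    simp only [← Finset.mul_sum]
    congr 1
    rw [Finset.sum_congr rfl fun i _ => sum_re_conj_mul_diagonal_conj hR d u i, Finset.sum_comm]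
    simp only [← Finset.mul_sum, sum_norm_sq_col_eq_one hP, mul_one]
  calc _ ≤ ∑ i, ∑ j, (‖E i j‖ ^ 2 * t⁻¹ - 2 * (star (E i j) * F i j).re + ‖F i j‖ ^ 2 * t +
        ‖F i j‖ ^ 2 * a i + ‖F i j‖ ^ 2 * b j) :=
        Finset.sum_le_sum fun i _ => Finset.sum_le_sum fun j _ => hpt i j
    _ = ∑ k, (d k ^ 2 * t⁻¹ - 2 * (d k * u k) + u k ^ 2 * t +
        u k ^ 2 * ∑ i, ‖P i k‖ ^ 2 * a i + u k ^ 2 * ∑ j, ‖R k j‖ ^ 2 * b j) := by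
        simp only [Finset.sum_add_distrib, Finset.sum_sub_distrib]
        rw [hE, hone, ← hE, hcross, hF, hone, sum_norm_sq_mul_diagonal_row hR,
          sum_norm_sq_mul_diagonal_col hP]
    _ = _ := Finset.sum_congr rfl fun k _ => by
        have h : t + x k ≠ 0 := by linarith [hx0 k]
        have h6 : u k ^ 2 * t + u k ^ 2 * ∑ i, ‖P i k‖ ^ 2 * a i +
          u k ^ 2 * ∑ j, ‖R k j‖ ^ 2 * b j = u k ^ 2 * (t + x k) := by rw [hx]; ring
        rw [add_assoc, add_assoc, ← add_assoc (u k ^ 2 * t), h6, hu]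
        field_simp
        ring

open Matrix in
theorem sum_norm_sq_mul_rpow_le {n : Type*} [Fintype n] [DecidableEq n]
    {P R : Matrix n n ℂ} (hP : Pᴴ * P = 1) (hR : R * Rᴴ = 1) (d a b : n → ℝ)
    (hab : ∀ i j, 0 ≤ a i + b j) {x : n → ℝ} (hx0 : ∀ k, 0 ≤ x k)
    (hx : ∀ k, x k = ∑ i, ‖P i k‖ ^ 2 * a i + ∑ j, ‖R k j‖ ^ 2 * b j) {q : ℝ}
    (hq0 : 0 ≤ q) (hq1 : q < 1) :
    ∑ i, ∑ j, ‖(P * diagonal (fun k => (d k : ℂ)) * R) i j‖ ^ 2 * (a i + b j) ^ q ≤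
      ∑ k, d k ^ 2 * x k ^ q := by
  rcases hq0.eq_or_lt with rfl | hq0
  · simp only [Real.rpow_zero]
    rw [sum_norm_sq_mul_diagonal_row hR d (fun _ => 1)]
    simp [sum_norm_sq_col_eq_one hP]
  obtain ⟨μ, hμ⟩ := Real.exists_measure_rpow_eq_integral_rpowIntegrand₀₁ (p := q) ⟨hq0, hq1⟩
  have h1 (i j : n) := hμ _ (Set.mem_Ici.2 (hab i j))
  have h2 (k : n) := hμ _ (Set.mem_Ici.2 (hx0 k))
  simp only [(h1 _ _).2, (h2 _).2, ← MeasureTheory.integral_const_mul]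
  have hi1 (i j : n) := ((h1 i j).1.integrable.const_mul
    (‖(P * diagonal (fun k => (d k : ℂ)) * R) i j‖ ^ 2))
  have hi2 (k : n) := ((h2 k).1.integrable.const_mul (d k ^ 2))
  have hrow (i : n) := MeasureTheory.integral_finsetSum Finset.univ fun j _ => hi1 i j
  rw [← MeasureTheory.integral_finsetSum Finset.univ fun k _ => hi2 k,
    Finset.sum_congr rfl fun i _ => (hrow i).symm,
    ← MeasureTheory.integral_finsetSum Finset.univ fun i _ =>
      MeasureTheory.integrable_finsetSum Finset.univ fun j _ => hi1 i j]
  refine MeasureTheory.setIntegral_mono_on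
    (MeasureTheory.integrable_finsetSum _ fun i _ =>
      MeasureTheory.integrable_finsetSum _ fun j _ => hi1 i j)
    (MeasureTheory.integrable_finsetSum _ fun k _ => hi2 k) measurableSet_Ioi fun t ht => ?_
  have := mul_le_mul_of_nonneg_left
    (sum_norm_sq_mul_div_add_le hP hR d a b hab hx0 hx (Set.mem_Ioi.1 ht))
    (Real.rpow_nonneg (le_of_lt ht) q)
  simp only [Finset.mul_sum] at this
  simp only [Real.rpowIntegrand₀₁]
  convert this using 1
  · exact Finset.sum_congr rfl fun i _ => Finset.sum_congr rfl fun j _ => by ring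
  · exact Finset.sum_congr rfl fun k _ => by ring

theorem sum_sq_mul_rpow_le_s8 {n : Type*} [Fintype n] {p : ℝ} (hp : 2 ≤ p) (d y : n → ℝ)
    (hy : ∀ k, 0 ≤ y k) :
    ∑ k, d k ^ 2 * y k ^ (p - 2) ≤
      (∑ k, |d k| ^ p) ^ (2 / p) * (∑ k, y k ^ p) ^ ((p - 2) / p) := by
  have hd (k : n) : (d k ^ 2) ^ (p / 2) = |d k| ^ p := by
    rw [← sq_abs, ← Real.rpow_natCast, ← Real.rpow_mul (abs_nonneg _)]
    congr 1
    push_cast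
    field_simp
  rcases hp.eq_or_lt with rfl | hp
  · simp
  have hp0 : 0 < p := by linarith
  have hp2 : 0 < p - 2 := by linarith
  have hconj : (p / 2).HolderConjugate (p / (p - 2)) := by
    rw [Real.holderConjugate_iff]
    constructor
    · linarith
    · field_simp; ring
  have := Real.inner_le_Lp_mul_Lq_of_nonneg Finset.univ hconj (f := fun k => d k ^ 2)
    (g := fun k => y k ^ (p - 2)) (fun k _ => sq_nonneg _) (fun k _ => Real.rpow_nonneg (hy k) _)
  simp only [hd, one_div_div] at this
  convert this using 4 with k
  rw [← Real.rpow_mul (hy k), mul_div_cancel₀ _ hp2.ne']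

theorem rpow_average_le {n : Type*} [Fintype n] {r : ℝ} (hr : 1 ≤ r) {α β a b : n → ℝ}
    (hα : ∀ i, 0 ≤ α i) (hβ : ∀ i, 0 ≤ β i) (hα1 : ∑ i, α i = 1) (hβ1 : ∑ i, β i = 1)
    (ha : ∀ i, 0 ≤ a i) (hb : ∀ i, 0 ≤ b i) :
    (∑ i, α i * (a i / 2) + ∑ i, β i * (b i / 2)) ^ r ≤
      ∑ i, α i * (a i ^ r / 2) + ∑ i, β i * (b i ^ r / 2) := by
  have h := Real.rpow_arith_mean_le_arith_mean_rpow Finset.univ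
    (Sum.elim (fun i => α i / 2) (fun i => β i / 2)) (Sum.elim a b)
    (by rintro (i | i) _
        · exact div_nonneg (hα i) zero_le_two
        · exact div_nonneg (hβ i) zero_le_two)
    (by simp [← Finset.sum_div, hα1, hβ1]; norm_num)
    (by rintro (i | i) _
        · exact ha i
        · exact hb i) hr
  simp only [Fintype.sum_sum_type, Sum.elim_inl, Sum.elim_inr] at h
  simp only [div_mul_eq_mul_div, ← mul_div_assoc] at h ⊢
  exact h

open Matrix in
theorem sum_norm_sq_mul_sub_mul_sub_le {n : Type*} [Fintype n] [DecidableEq n]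
    {P R W : Matrix n n ℂ} (hP : Pᴴ * P = 1) (hP' : P * Pᴴ = 1) (hR' : Rᴴ * R = 1) (hR : R * Rᴴ = 1)
    {p : ℝ} (hp : 2 ≤ p) (d a b : n → ℝ)
    (hW : ∀ i j, (P * diagonal (fun k => (d k : ℂ)) * R) i j = ((a i - b j : ℝ) : ℂ) * W i j) :
    ∑ i, ∑ j, ‖W i j‖ ^ 2 *
        ((a i - b j) * (|a i| ^ (p - 2) * a i - |b j| ^ (p - 2) * b j)) ≤
      (p - 1) * ((∑ k, |d k| ^ p) ^ (2 / p) *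
        ((∑ i, |a i| ^ p + ∑ j, |b j| ^ p) / 2) ^ ((p - 2) / p)) := by
  set E := P * diagonal (fun k => (d k : ℂ)) * R with hE
  have hnorm (i j : n) : ‖E i j‖ ^ 2 = (a i - b j) ^ 2 * ‖W i j‖ ^ 2 := by
    rw [hW, norm_mul, Complex.norm_real, mul_pow, Real.norm_eq_abs, sq_abs]
  have havg {r : ℝ} (hr : 1 ≤ r) (f : ℝ → ℝ) (hf : ∀ x, 0 ≤ f x) (hfr : ∀ x, f x ^ r = |x| ^ p) :
      ∑ k, (∑ i, ‖P i k‖ ^ 2 * (f (a i) / 2) + ∑ j, ‖R k j‖ ^ 2 * (f (b j) / 2)) ^ r ≤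
        (∑ i, |a i| ^ p + ∑ j, |b j| ^ p) / 2 := by
    calc _ ≤ ∑ k, (∑ i, ‖P i k‖ ^ 2 * (f (a i) ^ r / 2) + ∑ j, ‖R k j‖ ^ 2 * (f (b j) ^ r / 2)) :=
          Finset.sum_le_sum fun k _ => rpow_average_le hr (fun _ => by positivity)
            (fun _ => by positivity) (sum_norm_sq_col_eq_one hP k) (sum_norm_sq_row_eq_one hR k)
            (fun _ => hf _) (fun _ => hf _)
      _ = _ := by
          simp only [hfr]
          rw [Finset.sum_add_distrib, Finset.sum_comm, Finset.sum_comm (f := fun k j => ‖R k j‖ ^ 2 * _)]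
          simp only [← Finset.sum_mul, sum_norm_sq_row_eq_one hP', sum_norm_sq_col_eq_one hR',
            one_mul, ← Finset.sum_div]
          ring
  suffices h : ∃ y : n → ℝ, (∀ k, 0 ≤ y k) ∧
      (∑ k, y k ^ p ≤ (∑ i, |a i| ^ p + ∑ j, |b j| ^ p) / 2) ∧
      ∑ i, ∑ j, ‖W i j‖ ^ 2 *
        ((a i - b j) * (|a i| ^ (p - 2) * a i - |b j| ^ (p - 2) * b j)) ≤
        (p - 1) * ∑ k, d k ^ 2 * y k ^ (p - 2) by
    obtain ⟨y, hy0, hy, h⟩ := h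
    refine h.trans (mul_le_mul_of_nonneg_left ((sum_sq_mul_rpow_le_s8 hp d y hy0).trans ?_)
      (by linarith))
    exact mul_le_mul_of_nonneg_left (Real.rpow_le_rpow
      (Finset.sum_nonneg fun k _ => Real.rpow_nonneg (hy0 k) _) hy
      (div_nonneg (by linarith) (by linarith)))
      (Real.rpow_nonneg (Finset.sum_nonneg fun k _ => Real.rpow_nonneg (abs_nonneg _) _) _)
  rcases lt_or_ge (p - 2) 1 with hq | hq
  · have hx0 (k : n) : 0 ≤ ∑ i, ‖P i k‖ ^ 2 * (|a i| / 2) + ∑ j, ‖R k j‖ ^ 2 * (|b j| / 2) := by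
      positivity
    refine ⟨_, hx0, havg (r := p) (by linarith) (fun x => |x|) abs_nonneg fun _ => rfl, ?_⟩
    have h := sum_norm_sq_mul_rpow_le hP hR d (fun i => |a i| / 2) (fun j => |b j| / 2)
      (fun _ _ => by positivity) hx0 (fun _ => rfl) (by linarith : 0 ≤ p - 2) hq
    refine le_trans ?_ (mul_le_mul_of_nonneg_left h (by linarith))
    simp only [Finset.mul_sum]
    refine Finset.sum_le_sum fun i _ => Finset.sum_le_sum fun j _ => ?_
    have h2 := mul_le_mul_of_nonneg_left (sub_mul_sub_le_midpoint (by linarith) hq.le (a i) (b j))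
      (sq_nonneg ‖W i j‖)
    rw [← hE, hnorm, ← add_div]
    refine h2.trans (le_of_eq ?_)
    ring
  · have hq0 : 0 < p - 2 := by linarith
    set z : n → ℝ := fun k => ∑ i, ‖P i k‖ ^ 2 * (|a i| ^ (p - 2) / 2) +
      ∑ j, ‖R k j‖ ^ 2 * (|b j| ^ (p - 2) / 2) with hz
    have hz0 (k : n) : 0 ≤ z k := by positivity
    refine ⟨fun k => z k ^ (1 / (p - 2)), fun k => Real.rpow_nonneg (hz0 k) _, ?_, ?_⟩
    · have h := havg (r := p / (p - 2)) (by rw [one_le_div hq0]; linarith)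
        (fun x => |x| ^ (p - 2)) (fun _ => Real.rpow_nonneg (abs_nonneg _) _)
        (fun x => by rw [← Real.rpow_mul (abs_nonneg _), mul_div_cancel₀ _ hq0.ne'])
      refine le_trans (le_of_eq (Finset.sum_congr rfl fun k _ => ?_)) h
      rw [← Real.rpow_mul (hz0 k), one_div_mul_eq_div]
    · have hzq (k : n) : (z k ^ (1 / (p - 2))) ^ (p - 2) = z k := by
        rw [← Real.rpow_mul (hz0 k), one_div_mul_cancel hq0.ne', Real.rpow_one]
      have h := sum_norm_sq_mul_diagonal_row (P := P) hR d (fun i => |a i| ^ (p - 2) / 2)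
      have h' := sum_norm_sq_mul_diagonal_col (R := R) hP d (fun j => |b j| ^ (p - 2) / 2)
      simp only [hzq]
      simp only [hz, mul_add, Finset.sum_add_distrib]
      rw [← h, ← h', ← mul_add, ← Finset.sum_add_distrib]
      simp only [← Finset.sum_add_distrib, Finset.mul_sum]
      refine Finset.sum_le_sum fun i _ => Finset.sum_le_sum fun j _ => ?_
      have h2 := mul_le_mul_of_nonneg_left (sub_mul_sub_le_trapezoid hq (a i) (b j))
        (sq_nonneg ‖W i j‖)
      rw [← hE, hnorm]
      refine h2.trans (le_of_eq ?_)
      ring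

theorem continuous_of_sub_le_mul {F D : ℝ → ℝ} (h : ∀ s t, F t - F s ≤ (t - s) * D t) :
    Continuous F := by
  have hconv : ConvexOn ℝ Set.univ F := by
    refine ⟨convex_univ, fun x _ y _ a b ha hb hab => ?_⟩
    simp only [smul_eq_mul]
    have h1 := mul_le_mul_of_nonneg_left (h x (a * x + b * y)) ha
    have h2 := mul_le_mul_of_nonneg_left (h y (a * x + b * y)) hb
    obtain rfl : b = 1 - a := by linarith
    have h3 : a * ((a * x + (1 - a) * y - x) * D (a * x + (1 - a) * y)) +
      (1 - a) * ((a * x + (1 - a) * y - y) * D (a * x + (1 - a) * y)) = 0 := by ring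
    linarith
  rw [← continuousOn_univ]
  exact hconv.continuousOn isOpen_univ

/-- Integrating the differential inequality `G' ≤ p (p - 1) β t G ^ (1 - 2 / p)` for the even part
`G` of a convex function `F` with subgradient `D`. -/
theorem average_rpow_le_of_subgradient {F D : ℝ → ℝ} {p β : ℝ} (hp : 2 ≤ p) (hβ : 0 ≤ β)
    (hF : ∀ t, 0 ≤ F t) (h : ∀ s t, F t - F s ≤ (t - s) * D t)
    (hD : ∀ t, 0 < t →
      D t - D (-t) ≤ 2 * (p * (p - 1) * β * t * ((F t + F (-t)) / 2) ^ ((p - 2) / p))) :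
    ((F 1 + F (-1)) / 2) ^ (2 / p) ≤ F 0 ^ (2 / p) + (p - 1) * β := by
  have hp0 : 0 < p := by linarith
  have hFc := continuous_of_sub_le_mul h
  set G : ℝ → ℝ := fun t => (F t + F (-t)) / 2 with hG
  have hGc : Continuous G := by fun_prop
  have hG0 (t : ℝ) : 0 ≤ G t := div_nonneg (add_nonneg (hF _) (hF _)) zero_le_two
  have hGsub (s t : ℝ) (hst : s ≤ t) (ht : 0 < t) :
      G t - G s ≤ (t - s) * (p * (p - 1) * β * t * G t ^ ((p - 2) / p)) := by
    have h1 := h s t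
    have h2 := h (-s) (-t)
    have h3 := mul_le_mul_of_nonneg_left (hD t ht) (sub_nonneg.2 hst)
    simp only [hG]
    linarith
  have hexp : 2 / p - 1 = -((p - 2) / p) := by field_simp; ring
  have key (ε : ℝ) (hε : 0 < ε) :
      (G 1 + ε) ^ (2 / p) ≤ (G 0 + ε) ^ (2 / p) + (p - 1) * β := by
    have hpos (t : ℝ) : 0 < G t + ε := by linarith [hG0 t]
    have hcont : Continuous fun t => (G t + ε) ^ (2 / p) :=
      (hGc.add continuous_const).rpow_const fun t => Or.inl (hpos t).ne'
    have hslope (s t : ℝ) (hs : 0 ≤ s) (hst : s < t) :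
        slope (fun t => (G t + ε) ^ (2 / p)) s t ≤
          2 * (p - 1) * β * t * ((G t + ε) / (G s + ε)) ^ ((p - 2) / p) := by
      have hconc : (G t + ε) ^ (2 / p) ≤
          (G s + ε) ^ (2 / p) + 2 / p * (G s + ε) ^ (2 / p - 1) * (G t - G s) := by
        have hb := rpow_one_add_le_one_add_mul_self (s := (G t - G s) / (G s + ε)) (p := 2 / p)
          (by rw [le_div_iff₀ (hpos s)]; linarith [hG0 t]) (by positivity)
          (by rw [div_le_one hp0]; exact hp)
        rw [show 1 + (G t - G s) / (G s + ε) = (G t + ε) / (G s + ε) by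
          have := (hpos s).ne'; field_simp; ring, Real.div_rpow (hpos t).le (hpos s).le,
          div_le_iff₀ (Real.rpow_pos_of_pos (hpos s) _)] at hb
        refine hb.trans (le_of_eq ?_)
        rw [Real.rpow_sub_one (hpos s).ne']
        have := (hpos s).ne'
        field_simp
      have hbound : G t - G s ≤ (t - s) * (p * (p - 1) * β * t * (G t + ε) ^ ((p - 2) / p)) := by
        refine (hGsub s t hst.le (hs.trans_lt hst)).trans ?_
        have h1 : G t ^ ((p - 2) / p) ≤ (G t + ε) ^ ((p - 2) / p) :=
          Real.rpow_le_rpow (hG0 t) (by linarith) (div_nonneg (by linarith) hp0.le)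
        have h2 : 0 ≤ t - s := by linarith
        have h3 : 0 ≤ p * (p - 1) * β * t :=
          mul_nonneg (mul_nonneg (mul_nonneg hp0.le (by linarith)) hβ) (by linarith)
        gcongr
      have h4 : 0 ≤ 2 / p * (G s + ε) ^ (2 / p - 1) := by
        have := Real.rpow_pos_of_pos (hpos s) (2 / p - 1)
        positivity
      have h5 := mul_le_mul_of_nonneg_left hbound h4
      rw [slope_def_field, div_le_iff₀ (sub_pos.2 hst), Real.div_rpow (hpos t).le (hpos s).le]
      have h6 : 2 / p * (G s + ε) ^ (2 / p - 1) *
          ((t - s) * (p * (p - 1) * β * t * (G t + ε) ^ ((p - 2) / p))) =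
          2 * (p - 1) * β * t * ((G t + ε) ^ ((p - 2) / p) / (G s + ε) ^ ((p - 2) / p)) *
            (t - s) := by
        rw [hexp, Real.rpow_neg (hpos s).le]
        field_simp
      linarith
    have hfence := image_le_of_liminf_slope_right_le_deriv_boundary (a := 0) (b := 1)
      (f := fun t => (G t + ε) ^ (2 / p))
      (B := fun t => (G 0 + ε) ^ (2 / p) + (p - 1) * β * t ^ 2)
      (B' := fun t => 2 * (p - 1) * β * t) hcont.continuousOn (by simp) (by fun_prop)
      (fun x _ => by
        refine HasDerivAt.hasDerivWithinAt ?_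
        refine (((hasDerivAt_pow 2 x).const_mul ((p - 1) * β)).const_add _).congr_deriv ?_
        simp
        ring)
      (fun x hx r hr => by
        have hlim : Filter.Tendsto
            (fun t => 2 * (p - 1) * β * t * ((G t + ε) / (G x + ε)) ^ ((p - 2) / p))
            (nhdsWithin x (Set.Ioi x)) (nhds (2 * (p - 1) * β * x)) := by
          have hc : Continuous
              fun t => 2 * (p - 1) * β * t * ((G t + ε) / (G x + ε)) ^ ((p - 2) / p) := by
            refine Continuous.mul (by fun_prop) (Continuous.rpow_const (by fun_prop) fun t => ?_)
            exact Or.inl (div_pos (hpos t) (hpos x)).ne'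
          have := (hc.tendsto x).mono_left (nhdsWithin_le_nhds (s := Set.Ioi x))
          simpa [div_self (hpos x).ne'] using this
        refine Filter.Eventually.frequently ?_
        filter_upwards [hlim.eventually_lt_const hr, self_mem_nhdsWithin] with t ht hxt
        exact (hslope x t hx.1 hxt).trans_lt ht)
      (Set.right_mem_Icc.2 zero_le_one)
    simpa using hfence
  have hcε (c : ℝ) : Continuous fun ε : ℝ => (c + ε) ^ (2 / p) :=
    Continuous.rpow_const (by fun_prop) fun _ => Or.inr (by positivity)
  have hlim1 := ((hcε (G 1)).tendsto 0).mono_left (nhdsWithin_le_nhds (s := Set.Ioi 0))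
  have hlim0 := (((hcε (G 0)).tendsto 0).mono_left
    (nhdsWithin_le_nhds (s := Set.Ioi 0))).add_const ((p - 1) * β)
  have hle := le_of_tendsto_of_tendsto hlim1 hlim0
    (by filter_upwards [self_mem_nhdsWithin] with ε hε using key ε hε)
  have h0 : G 0 = F 0 := by simp [hG]
  simpa [h0] using hle

section UnitaryDiag

open Matrix

variable {n : Type*} [Fintype n] [DecidableEq n]

/-- The matrix `U * diag d * Uᴴ` for a real vector `d`. -/
noncomputable def conjDiagonal (U : Matrix n n ℂ) (d : n → ℝ) : Matrix n n ℂ :=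
  U * diagonal (fun k => (d k : ℂ)) * Uᴴ

theorem re_trace_conjDiagonal_mul (U V : Matrix n n ℂ) (f h : n → ℝ) :
    (conjDiagonal U f * conjDiagonal V h).trace.re =
      ∑ i, ∑ j, ‖(Uᴴ * V) i j‖ ^ 2 * (f i * h j) := by
  have h1 : (conjDiagonal U f * conjDiagonal V h).trace =
      (diagonal (fun k => (f k : ℂ)) * (Uᴴ * V) * diagonal (fun k => (h k : ℂ)) *
        (Uᴴ * V)ᴴ).trace := by
    rw [conjDiagonal, conjDiagonal, Matrix.mul_assoc U, Matrix.mul_assoc U, trace_mul_comm U,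
      conjTranspose_mul, conjTranspose_conjTranspose]
    simp only [Matrix.mul_assoc]
  rw [h1, trace, Complex.re_sum]
  refine Finset.sum_congr rfl fun i _ => ?_
  rw [diag_apply, mul_apply, Complex.re_sum]
  refine Finset.sum_congr rfl fun j _ => ?_
  rw [mul_diagonal, diagonal_mul, conjTranspose_apply, mul_right_comm, mul_assoc (f i : ℂ),
    Complex.star_def, Complex.mul_conj, Complex.normSq_eq_norm_sq, ← Complex.ofReal_mul,
    ← Complex.ofReal_mul, Complex.ofReal_re]
  ring

theorem re_trace_conjDiagonal_mul_self {U : Matrix n n ℂ} (hU : Uᴴ * U = 1) (f h : n → ℝ) :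
    (conjDiagonal U f * conjDiagonal U h).trace.re = ∑ i, f i * h i := by
  rw [re_trace_conjDiagonal_mul, hU]
  refine Finset.sum_congr rfl fun i _ => ?_
  rw [Finset.sum_eq_single i (fun j _ hj => by rw [one_apply_ne' hj]; simp) (by simp)]
  simp

theorem conjTranspose_mul_mul_self {U V : Matrix n n ℂ} (hU : U * Uᴴ = 1) (hV : Vᴴ * V = 1) :
    (Uᴴ * V)ᴴ * (Uᴴ * V) = 1 := by
  rw [conjTranspose_mul, conjTranspose_conjTranspose, Matrix.mul_assoc, ← Matrix.mul_assoc U,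
    hU, Matrix.one_mul, hV]

theorem mul_conjTranspose_mul_self {U V : Matrix n n ℂ} (hU : Uᴴ * U = 1) (hV : V * Vᴴ = 1) :
    (Uᴴ * V) * (Uᴴ * V)ᴴ = 1 := by
  rw [conjTranspose_mul, conjTranspose_conjTranspose, Matrix.mul_assoc, ← Matrix.mul_assoc V,
    hV, Matrix.one_mul, hU]

/-- Klein's inequality for the function `x ↦ |x| ^ p`. -/
theorem sum_abs_rpow_sub_le {U V : Matrix n n ℂ} (hU : Uᴴ * U = 1) (hU' : U * Uᴴ = 1)
    (hV : Vᴴ * V = 1) (hV' : V * Vᴴ = 1) {p : ℝ} (hp : 2 ≤ p) (a b : n → ℝ) :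
    ∑ i, |a i| ^ p - ∑ j, |b j| ^ p ≤
      p * (conjDiagonal U (fun i => |a i| ^ (p - 2) * a i) *
        (conjDiagonal U a - conjDiagonal V b)).trace.re := by
  have hrow := sum_norm_sq_row_eq_one (mul_conjTranspose_mul_self hU hV')
  have hcol := sum_norm_sq_col_eq_one (conjTranspose_mul_mul_self hU' hV)
  have h1 (f : n → ℝ) : ∑ i, f i = ∑ i, ∑ j, ‖(Uᴴ * V) i j‖ ^ 2 * f i := by
    simp only [← Finset.sum_mul, hrow, one_mul]
  have h2 (f : n → ℝ) : ∑ j, f j = ∑ i, ∑ j, ‖(Uᴴ * V) i j‖ ^ 2 * f j := by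
    rw [Finset.sum_comm]
    simp only [← Finset.sum_mul, hcol, one_mul]
  rw [Matrix.mul_sub, trace_sub, Complex.sub_re, re_trace_conjDiagonal_mul_self hU,
    re_trace_conjDiagonal_mul, h1 (fun i => |a i| ^ p), h2 (fun j => |b j| ^ p),
    h1 (fun i => |a i| ^ (p - 2) * a i * a i)]
  simp only [← Finset.sum_sub_distrib, Finset.mul_sum]
  refine Finset.sum_le_sum fun i _ => Finset.sum_le_sum fun j _ => ?_
  have := mul_le_mul_of_nonneg_left (abs_rpow_sub_abs_rpow_le hp (a i) (b j))
    (sq_nonneg ‖(Uᴴ * V) i j‖)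
  linarith

theorem re_trace_conjDiagonal_sub_mul_le {U V Q : Matrix n n ℂ} (hU : Uᴴ * U = 1)
    (hU' : U * Uᴴ = 1) (hV : Vᴴ * V = 1) (hV' : V * Vᴴ = 1) (hQ : Qᴴ * Q = 1) (hQ' : Q * Qᴴ = 1)
    {p : ℝ} (hp : 2 ≤ p) (a b d : n → ℝ)
    (h : conjDiagonal U a - conjDiagonal V b = conjDiagonal Q d) :
    ((conjDiagonal U (fun i => |a i| ^ (p - 2) * a i) -
        conjDiagonal V (fun i => |b i| ^ (p - 2) * b i)) * conjDiagonal Q d).trace.re ≤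
      (p - 1) * ((∑ k, |d k| ^ p) ^ (2 / p) *
        ((∑ i, |a i| ^ p + ∑ j, |b j| ^ p) / 2) ^ ((p - 2) / p)) := by
  have hrow := sum_norm_sq_row_eq_one (mul_conjTranspose_mul_self hU hV')
  have hcol := sum_norm_sq_col_eq_one (conjTranspose_mul_mul_self hU' hV)
  have h1 (f : n → ℝ) : ∑ i, f i = ∑ i, ∑ j, ‖(Uᴴ * V) i j‖ ^ 2 * f i := by
    simp only [← Finset.sum_mul, hrow, one_mul]
  have h2 (f : n → ℝ) : ∑ j, f j = ∑ i, ∑ j, ‖(Uᴴ * V) i j‖ ^ 2 * f j := by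
    rw [Finset.sum_comm]
    simp only [← Finset.sum_mul, hcol, one_mul]
  have hW (i j : n) : ((Uᴴ * Q) * diagonal (fun k => (d k : ℂ)) * (Qᴴ * V)) i j =
      ((a i - b j : ℝ) : ℂ) * (Uᴴ * V) i j := by
    have h3 : (Uᴴ * Q) * diagonal (fun k => (d k : ℂ)) * (Qᴴ * V) =
        diagonal (fun k => (a k : ℂ)) * (Uᴴ * V) - (Uᴴ * V) * diagonal (fun k => (b k : ℂ)) := by
      calc _ = Uᴴ * conjDiagonal Q d * V := by simp only [conjDiagonal, Matrix.mul_assoc]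
        _ = (Uᴴ * U) * diagonal (fun k => (a k : ℂ)) * (Uᴴ * V) -
            (Uᴴ * V) * diagonal (fun k => (b k : ℂ)) * (Vᴴ * V) := by
          rw [← h]
          simp only [conjDiagonal, Matrix.mul_sub, Matrix.sub_mul, Matrix.mul_assoc]
        _ = _ := by rw [hU, hV, Matrix.one_mul, Matrix.mul_one]
    rw [h3, Matrix.sub_apply, diagonal_mul, mul_diagonal]
    push_cast
    ring
  have hVQ : Qᴴ * V * (Qᴴ * V)ᴴ = 1 := mul_conjTranspose_mul_self hQ hV'
  refine le_trans (le_of_eq ?_) (sum_norm_sq_mul_sub_mul_sub_le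
    (conjTranspose_mul_mul_self hU' hQ) (mul_conjTranspose_mul_self hU hQ')
    (conjTranspose_mul_mul_self hQ' hV) hVQ hp d a b hW)
  have hcomm : (conjDiagonal V (fun i => |b i| ^ (p - 2) * b i) * conjDiagonal U a).trace.re =
      ∑ i, ∑ j, ‖(Uᴴ * V) i j‖ ^ 2 * (a i * (|b j| ^ (p - 2) * b j)) := by
    rw [trace_mul_comm, re_trace_conjDiagonal_mul]
  rw [← h, Matrix.sub_mul, Matrix.mul_sub, Matrix.mul_sub, trace_sub, trace_sub, trace_sub,
    Complex.sub_re, Complex.sub_re, Complex.sub_re, re_trace_conjDiagonal_mul_self hU,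
    re_trace_conjDiagonal_mul_self hV, re_trace_conjDiagonal_mul, hcomm,
    h1 (fun i => |a i| ^ (p - 2) * a i * a i), h2 (fun i => |b i| ^ (p - 2) * b i * b i)]
  simp only [← Finset.sum_sub_distrib]
  exact Finset.sum_congr rfl fun i _ => Finset.sum_congr rfl fun j _ => by ring

theorem Matrix.IsHermitian.conjDiagonal_eq {X : Matrix n n ℂ} (hX : X.IsHermitian) :
    conjDiagonal (hX.eigenvectorUnitary : Matrix n n ℂ) hX.eigenvalues = X := by
  conv_rhs => rw [hX.spectral_theorem, Unitary.conjStarAlgAut_apply]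
  rfl

theorem conjDiagonal_smul (U : Matrix n n ℂ) (d : n → ℝ) (c : ℝ) :
    conjDiagonal U (fun i => c * d i) = (c : ℂ) • conjDiagonal U d := by
  have : diagonal (fun k => ((c * d k : ℝ) : ℂ)) = (c : ℂ) • diagonal (fun k => (d k : ℂ)) := by
    rw [← diagonal_smul]
    congr 1
    ext k
    simp
  rw [conjDiagonal, this, Matrix.mul_smul, Matrix.smul_mul, conjDiagonal]

theorem sum_eigenvalues_eq_of_charpoly_eq {X : Matrix n n ℂ} (hX : X.IsHermitian) {d : n → ℝ}
    (h : X.charpoly = (diagonal (fun k => (d k : ℂ))).charpoly) (f : ℝ → ℝ) :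
    ∑ i, f (hX.eigenvalues i) = ∑ i, f (d i) := by
  have h1 := hX.roots_charpoly_eq_eigenvalues
  rw [h, charpoly_diagonal, Polynomial.roots_prod _ _
    (Finset.prod_ne_zero_iff.2 fun _ _ => Polynomial.X_sub_C_ne_zero _)] at h1
  simp only [Polynomial.roots_X_sub_C, Multiset.bind_singleton] at h1
  have h2 := congrArg (fun s => (s.map (fun z : ℂ => f z.re)).sum) h1
  simp only [Multiset.map_map, Function.comp_apply, Complex.ofReal_re] at h2
  simpa using h2.symm

theorem charpoly_conjDiagonal {U : Matrix n n ℂ} (hU : Uᴴ * U = 1) (d : n → ℝ) :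
    (conjDiagonal U d).charpoly = (diagonal (fun k => (d k : ℂ))).charpoly := by
  rw [conjDiagonal, Matrix.mul_assoc, charpoly_mul_comm, Matrix.mul_assoc, hU, Matrix.mul_one]

theorem Matrix.IsHermitian.sum_abs_eigenvalues_rpow_le {A B : Matrix n n ℂ} (hA : A.IsHermitian)
    (hB : B.IsHermitian) {p : ℝ} (hp : 2 ≤ p) :
    ((∑ i, |(hA.add hB).eigenvalues i| ^ p + ∑ i, |(hA.sub hB).eigenvalues i| ^ p) / 2) ^ (2 / p) ≤
      (∑ i, |hA.eigenvalues i| ^ p) ^ (2 / p) +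
        (p - 1) * (∑ i, |hB.eigenvalues i| ^ p) ^ (2 / p) := by
  have hl (t : ℝ) : (A + (t : ℂ) • B).IsHermitian := by
    refine hA.add ?_
    rw [IsHermitian, conjTranspose_smul, hB.eq, Complex.star_def, Complex.conj_ofReal]
  have hU {X : Matrix n n ℂ} (hX : X.IsHermitian) :
      (hX.eigenvectorUnitary : Matrix n n ℂ)ᴴ * hX.eigenvectorUnitary = 1 :=
    Unitary.coe_star_mul_self _
  have hU' {X : Matrix n n ℂ} (hX : X.IsHermitian) :
      (hX.eigenvectorUnitary : Matrix n n ℂ) * (hX.eigenvectorUnitary : Matrix n n ℂ)ᴴ = 1 :=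
    Unitary.coe_mul_star_self _
  set S : ℝ → Matrix n n ℂ := fun t => conjDiagonal ((hl t).eigenvectorUnitary : Matrix n n ℂ)
    (fun i => |(hl t).eigenvalues i| ^ (p - 2) * (hl t).eigenvalues i) with hS
  have hdiff (s t : ℝ) : A + (t : ℂ) • B - (A + (s : ℂ) • B) = ((t - s : ℝ) : ℂ) • B := by
    rw [add_sub_add_left_eq_sub, ← sub_smul]; push_cast; rfl
  have h := average_rpow_le_of_subgradient (F := fun t => ∑ i, |(hl t).eigenvalues i| ^ p)
    (D := fun t => p * (S t * B).trace.re) (β := (∑ i, |hB.eigenvalues i| ^ p) ^ (2 / p)) hp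
    (by positivity) (fun t => by positivity)
    (fun s t => by
      refine (sum_abs_rpow_sub_le (hU (hl t)) (hU' (hl t)) (hU (hl s)) (hU' (hl s)) hp _ _).trans
        (le_of_eq ?_)
      rw [(hl t).conjDiagonal_eq, (hl s).conjDiagonal_eq, hdiff, Matrix.mul_smul, trace_smul,
        smul_eq_mul, Complex.re_ofReal_mul]
      ring)
    (fun t ht => by
      have hd : conjDiagonal ((hl t).eigenvectorUnitary : Matrix n n ℂ) (hl t).eigenvalues -
          conjDiagonal ((hl (-t)).eigenvectorUnitary : Matrix n n ℂ) (hl (-t)).eigenvalues =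
          conjDiagonal (hB.eigenvectorUnitary : Matrix n n ℂ)
            (fun i => (2 * t) * hB.eigenvalues i) := by
        rw [(hl t).conjDiagonal_eq, (hl (-t)).conjDiagonal_eq, conjDiagonal_smul,
          hB.conjDiagonal_eq, hdiff]
        congr 2
        ring
      have h := re_trace_conjDiagonal_sub_mul_le (hU (hl t)) (hU' (hl t)) (hU (hl (-t)))
        (hU' (hl (-t))) (hU hB) (hU' hB) hp _ _ _ hd
      have ht2 : 0 < 2 * t := by linarith
      have hsum : (∑ i, |2 * t * hB.eigenvalues i| ^ p) ^ (2 / p) =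
          (2 * t) ^ 2 * (∑ i, |hB.eigenvalues i| ^ p) ^ (2 / p) := by
        simp only [abs_mul (2 * t), abs_of_pos ht2, Real.mul_rpow ht2.le (abs_nonneg _),
          ← Finset.mul_sum]
        rw [Real.mul_rpow (by positivity) (by positivity), ← Real.rpow_mul ht2.le,
          mul_div_cancel₀ _ (by linarith : p ≠ 0), Real.rpow_two]
      rw [hsum, conjDiagonal_smul, hB.conjDiagonal_eq, Matrix.mul_smul, trace_smul, smul_eq_mul,
        Complex.re_ofReal_mul, Matrix.sub_mul, trace_sub, Complex.sub_re] at h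
      refine le_of_mul_le_mul_left ?_ ht2
      have h2 := mul_le_mul_of_nonneg_left h (by linarith : 0 ≤ p)
      simp only [hS]
      refine (le_of_eq ?_).trans (h2.trans (le_of_eq ?_)) <;> ring)
  have h1 : A + ((1 : ℝ) : ℂ) • B = A + B := by simp
  have h2 : A + ((-1 : ℝ) : ℂ) • B = A - B := by simp [sub_eq_add_neg]
  have h3 : A + ((0 : ℝ) : ℂ) • B = A := by simp
  simpa only [h1, h2, h3] using h

end UnitaryDiag

section Dilation

open Matrix

theorem isHermitian_fromBlocks_conjTranspose {m : Type*} (X : Matrix m m ℂ) :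
    (fromBlocks 0 X Xᴴ 0).IsHermitian := by
  rw [IsHermitian, fromBlocks_conjTranspose]
  simp

variable {m : Type*} [Fintype m] [DecidableEq m]

theorem sum_abs_eigenvalues_fromBlocks_rpow {p : ℝ} (X : Matrix m m ℂ) :
    ∑ i, |(isHermitian_fromBlocks_conjTranspose X).eigenvalues i| ^ p =
      2 * ∑ i, (posSemidef_conjTranspose_mul_self X).1.eigenvalues i ^ (p / 2) := by
  have hX := isHermitian_fromBlocks_conjTranspose X
  have hP := posSemidef_conjTranspose_mul_self X
  set Y := fromBlocks 0 X Xᴴ 0 with hY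
  have hYY : Y * Y = fromBlocks (X * Xᴴ) 0 0 (Xᴴ * X) := by
    rw [hY, fromBlocks_multiply]; simp
  have hU : (hX.eigenvectorUnitary : Matrix (m ⊕ m) (m ⊕ m) ℂ)ᴴ * hX.eigenvectorUnitary = 1 :=
    Unitary.coe_star_mul_self _
  have hsq : Y * Y = conjDiagonal (hX.eigenvectorUnitary : Matrix (m ⊕ m) (m ⊕ m) ℂ)
      (fun i => hX.eigenvalues i ^ 2) := by
    conv_lhs => rw [← hX.conjDiagonal_eq]
    rw [conjDiagonal, conjDiagonal]
    calc _ = (hX.eigenvectorUnitary : Matrix (m ⊕ m) (m ⊕ m) ℂ) *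
        diagonal (fun k => (hX.eigenvalues k : ℂ)) *
        ((hX.eigenvectorUnitary : Matrix (m ⊕ m) (m ⊕ m) ℂ)ᴴ * hX.eigenvectorUnitary) *
        diagonal (fun k => (hX.eigenvalues k : ℂ)) *
        (hX.eigenvectorUnitary : Matrix (m ⊕ m) (m ⊕ m) ℂ)ᴴ := by simp only [Matrix.mul_assoc]
      _ = _ := by
        rw [hU, Matrix.mul_one, Matrix.mul_assoc _ (diagonal _) (diagonal _),
          diagonal_mul_diagonal]
        congr 3
        ext k
        push_cast
        ring
  have hYYh : (Y * Y).IsHermitian := by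
    rw [IsHermitian, conjTranspose_mul, hX.eq]
  have h1 := sum_eigenvalues_eq_of_charpoly_eq hYYh
    (by rw [hsq]; exact charpoly_conjDiagonal hU _) (fun x => x ^ (p / 2))
  have h2 := sum_eigenvalues_eq_of_charpoly_eq hYYh
    (d := Sum.elim hP.1.eigenvalues hP.1.eigenvalues)
    (by rw [hYY, charpoly_fromBlocks_zero₁₂, charpoly_mul_comm, hP.1.charpoly_eq,
          charpoly_diagonal, Fintype.prod_sum_type]
        rfl) (fun x => x ^ (p / 2))
  rw [two_mul]
  refine Eq.trans ?_ (h1.symm.trans (h2.trans (Fintype.sum_sum_type _)))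
  refine Finset.sum_congr rfl fun i _ => ?_
  rw [← sq_abs, ← Real.rpow_natCast, ← Real.rpow_mul (abs_nonneg _)]
  congr 1
  push_cast
  field_simp

theorem schattenNorm_rpow_eq_half_sum {p : ℝ} (hp : p ≠ 0) (X : Matrix m m ℂ) :
    2 * schattenNorm p X ^ p =
      ∑ i, |(isHermitian_fromBlocks_conjTranspose X).eigenvalues i| ^ p := by
  have h : 0 ≤ ∑ i, (posSemidef_conjTranspose_mul_self X).1.eigenvalues i ^ (p / 2) :=
    Finset.sum_nonneg fun i _ =>
      Real.rpow_nonneg ((posSemidef_conjTranspose_mul_self X).eigenvalues_nonneg i) _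
  rw [sum_abs_eigenvalues_fromBlocks_rpow, schattenNorm, ← Real.rpow_mul h,
    one_div_mul_cancel hp, Real.rpow_one]

theorem schattenNorm_nonneg {p : ℝ} (X : Matrix m m ℂ) : 0 ≤ schattenNorm p X :=
  Real.rpow_nonneg (Finset.sum_nonneg fun i _ =>
    Real.rpow_nonneg ((posSemidef_conjTranspose_mul_self X).eigenvalues_nonneg i) _) _

end Dilation

theorem ball_carlen_lieb_reversed {m : Type*} [Fintype m] [DecidableEq m]
    (A B : Matrix m m ℂ) (p : ℝ) (hp : 2 ≤ p) :
    ((schattenNorm p (A + B) ^ p + schattenNorm p (A - B) ^ p) / 2) ^ (2 / p) ≤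
      schattenNorm p A ^ (2 : ℝ) + (p - 1) * schattenNorm p B ^ (2 : ℝ) := by
  have hp0 : p ≠ 0 := by linarith
  have h := (isHermitian_fromBlocks_conjTranspose A).sum_abs_eigenvalues_rpow_le
    (isHermitian_fromBlocks_conjTranspose B) hp
  have hadd : Matrix.fromBlocks 0 A A.conjTranspose 0 + Matrix.fromBlocks 0 B B.conjTranspose 0 =
      Matrix.fromBlocks 0 (A + B) (A + B).conjTranspose 0 := by
    rw [Matrix.fromBlocks_add, Matrix.conjTranspose_add]; simp
  have hsub : Matrix.fromBlocks 0 A A.conjTranspose 0 - Matrix.fromBlocks 0 B B.conjTranspose 0 =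
      Matrix.fromBlocks 0 (A - B) (A - B).conjTranspose 0 := by
    ext (i | i) (j | j) <;> simp
  simp only [hadd, hsub, ← schattenNorm_rpow_eq_half_sum hp0] at h
  have hn (X : Matrix m m ℂ) : 0 ≤ schattenNorm p X ^ p :=
    Real.rpow_nonneg (schattenNorm_nonneg X) _
  have hsq (X : Matrix m m ℂ) : (schattenNorm p X ^ p) ^ (2 / p) = schattenNorm p X ^ (2 : ℝ) := by
    rw [← Real.rpow_mul (schattenNorm_nonneg X), mul_div_cancel₀ _ hp0]
  rw [← mul_add, mul_div_assoc, Real.mul_rpow zero_le_two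
    (div_nonneg (add_nonneg (hn _) (hn _)) zero_le_two), Real.mul_rpow zero_le_two (hn _),
    Real.mul_rpow zero_le_two (hn _), hsq, hsq, mul_left_comm, ← mul_add] at h
  exact le_of_mul_le_mul_left h (Real.rpow_pos_of_pos zero_lt_two _)
end
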